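/- arXiv:1501.07628 — 2 statements merged into one kernel-verified Lean document; each statement's English description precedes it below -/
import Mathlib

section
/- Let Λ be the preprojective algebra of a Dynkin quiver. For any finite-dimensional Λ-modules X and Y, dim Ext¹_Λ(X,Y) = dim Hom_Λ(X,Y) + dim Hom_Λ(Y,X) − (dim X, dim Y), where (−,−) is the symmetrized Cartan form on dimension vectors. In particular dim Ext¹_Λ(X,Y) = dim Ext¹_Λ(Y,X). -/
noncomputable section
open Module

/-! The preprojective algebra `Λ = Λ(Q)` of a quiver `Q` whose underlying graph is a
(simply-laced) Dynkin diagram with Cartan matrix `C`, constructed as the quotient of the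
path algebra of the double quiver `Q̄` (realized inside the free algebra on the vertex
idempotents and the arrows) by the preprojective relations `∑_a ε(a) a a* = 0`.
`sgn i j` is the sign `ε` of the arrow `i → j` of `Q̄` (`+1` on `Ω`, `−1` on `Ω*`). -/

/-- Generators of the path algebra of the double quiver: one idempotent per vertex and
one arrow `i → j` for every pair of adjacent vertices `i, j`. -/
inductive PGen (I : Type) : Type
  | idem : I → PGen I
  | arrow : I → I → PGen I

variable {I : Type} [Fintype I] [DecidableEq I]

open PGen in
/-- The defining relations of the preprojective algebra: the path-algebra relations for
the idempotents and arrows of the double quiver of the graph of `C` (the generator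
`arrow i j` is set to `0` when `i` and `j` are not adjacent), and the preprojective
relations `∑_{a : t(a) = i} ε(a) a a* = 0`. -/
inductive PRel (C : I → I → ℤ) (sgn : I → I → ℤ) :
    FreeAlgebra ℂ (PGen I) → FreeAlgebra ℂ (PGen I) → Prop
  | idem_mul (i j : I) :
      PRel C sgn (FreeAlgebra.ι ℂ (idem i) * FreeAlgebra.ι ℂ (idem j))
        (if i = j then FreeAlgebra.ι ℂ (idem i) else 0)
  | idem_sum : PRel C sgn (∑ i : I, FreeAlgebra.ι ℂ (idem i)) 1
  | arrow_src (i j : I) :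
      PRel C sgn (FreeAlgebra.ι ℂ (arrow i j) * FreeAlgebra.ι ℂ (idem i))
        (FreeAlgebra.ι ℂ (arrow i j))
  | arrow_tgt (i j : I) :
      PRel C sgn (FreeAlgebra.ι ℂ (idem j) * FreeAlgebra.ι ℂ (arrow i j))
        (FreeAlgebra.ι ℂ (arrow i j))
  | arrow_zero (i j : I) (h : C i j ≠ -1) :
      PRel C sgn (FreeAlgebra.ι ℂ (arrow i j)) 0
  | preproj (i : I) :
      PRel C sgn
        (∑ j : I, sgn j i • (FreeAlgebra.ι ℂ (arrow j i) * FreeAlgebra.ι ℂ (arrow i j))) 0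

/-- The preprojective algebra of the graph of `C` (with signs `sgn`). -/
def PreprojAlg (C : I → I → ℤ) (sgn : I → I → ℤ) : Type := RingQuot (PRel C sgn)

instance (C sgn : I → I → ℤ) : Ring (PreprojAlg C sgn) :=
  inferInstanceAs (Ring (RingQuot (PRel C sgn)))
instance (C sgn : I → I → ℤ) : Algebra ℂ (PreprojAlg C sgn) :=
  inferInstanceAs (Algebra ℂ (RingQuot (PRel C sgn)))

/-- The vertex idempotent `e_i ∈ Λ`. -/
def pe (C sgn : I → I → ℤ) (i : I) : PreprojAlg C sgn :=
  RingQuot.mkRingHom (PRel C sgn) (FreeAlgebra.ι ℂ (PGen.idem i))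

/-- The ℂ-linear action of the idempotent `e_i` on a `Λ`-module `X`. -/
def smulIdem (C sgn : I → I → ℤ) (X : Type) [AddCommGroup X] [Module ℂ X]
    [Module (PreprojAlg C sgn) X] [SMulCommClass (PreprojAlg C sgn) ℂ X] (i : I) :
    X →ₗ[ℂ] X where
  toFun x := pe C sgn i • x
  map_add' x y := smul_add _ x y
  map_smul' c x := smul_comm _ c x

/-- The dimension vector of a `Λ`-module `X`: `(dim X)_i = dim_ℂ (e_i X)`. -/
def dimv (C sgn : I → I → ℤ) (X : Type) [AddCommGroup X] [Module ℂ X]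
    [Module (PreprojAlg C sgn) X] [SMulCommClass (PreprojAlg C sgn) ℂ X] (i : I) : ℕ :=
  finrank ℂ (LinearMap.range (smulIdem C sgn X i))

/-- Composition with `ι` as a ℂ-linear map between `Λ`-homomorphism spaces. -/
def precomp {Λ : Type} [Ring Λ] {K P M : Type}
    [AddCommGroup K] [Module Λ K] [AddCommGroup P] [Module Λ P]
    [AddCommGroup M] [Module Λ M] [Module ℂ M] [SMulCommClass Λ ℂ M]
    (ι : K →ₗ[Λ] P) : (P →ₗ[Λ] M) →ₗ[ℂ] (K →ₗ[Λ] M) where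
  toFun g := g.comp ι
  map_add' g h := by ext x; simp
  map_smul' c g := by ext x; simp

/-- `dim Ext¹_Λ(C, M)` computed from a projective presentation `0 → K → P → C → 0` of
`C`: the dimension of the cokernel of `Hom_Λ(P,M) → Hom_Λ(K,M)`. -/
def ext1dim {Λ : Type} [Ring Λ] {K P : Type}
    [AddCommGroup K] [Module Λ K] [AddCommGroup P] [Module Λ P]
    (ι : K →ₗ[Λ] P) (M : Type)
    [AddCommGroup M] [Module Λ M] [Module ℂ M] [SMulCommClass Λ ℂ M] : ℕ :=
  finrank ℂ ((K →ₗ[Λ] M) ⧸ LinearMap.range (precomp (M := M) ι))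

section PreprojectiveModules

variable (C sgn : I → I → ℤ)

/-- The element of `Λ` given by the arrow `i → j`. -/
def pa (i j : I) : PreprojAlg C sgn :=
  RingQuot.mkRingHom (PRel C sgn) (FreeAlgebra.ι ℂ (PGen.arrow i j))

/-- The quotient map from the free algebra onto `Λ`. -/
def preprojMk : FreeAlgebra ℂ (PGen I) →ₐ[ℂ] PreprojAlg C sgn :=
  RingQuot.mkAlgHom ℂ (PRel C sgn)

variable {C sgn} in
lemma preprojMk_rel {x y : FreeAlgebra ℂ (PGen I)} (h : PRel C sgn x y) :
    preprojMk C sgn x = preprojMk C sgn y :=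
  RingQuot.mkAlgHom_rel ℂ h

lemma preprojMk_idem (i : I) : preprojMk C sgn (FreeAlgebra.ι ℂ (PGen.idem i)) = pe C sgn i :=
  congr($(RingQuot.mkAlgHom_coe ℂ (PRel C sgn)) (FreeAlgebra.ι ℂ (PGen.idem i)))

lemma preprojMk_arrow (i j : I) :
    preprojMk C sgn (FreeAlgebra.ι ℂ (PGen.arrow i j)) = pa C sgn i j :=
  congr($(RingQuot.mkAlgHom_coe ℂ (PRel C sgn)) (FreeAlgebra.ι ℂ (PGen.arrow i j)))

lemma pe_mul_pe (i j : I) : pe C sgn i * pe C sgn j = if i = j then pe C sgn i else 0 := by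
  have h := preprojMk_rel (PRel.idem_mul (C := C) (sgn := sgn) i j)
  rwa [map_mul, apply_ite (preprojMk C sgn), map_zero, preprojMk_idem, preprojMk_idem] at h

lemma sum_pe : ∑ i, pe C sgn i = 1 := by
  simpa only [map_sum, map_one, preprojMk_idem] using
    preprojMk_rel (PRel.idem_sum (C := C) (sgn := sgn))

lemma pa_mul_pe_self (i j : I) : pa C sgn i j * pe C sgn i = pa C sgn i j := by
  simpa only [map_mul, preprojMk_idem, preprojMk_arrow] using
    preprojMk_rel (PRel.arrow_src (C := C) (sgn := sgn) i j)

lemma pe_mul_pa_self (i j : I) : pe C sgn j * pa C sgn i j = pa C sgn i j := by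
  simpa only [map_mul, preprojMk_idem, preprojMk_arrow] using
    preprojMk_rel (PRel.arrow_tgt (C := C) (sgn := sgn) i j)

lemma pa_eq_zero {i j : I} (hij : C i j ≠ -1) : pa C sgn i j = 0 := by
  simpa only [map_zero, preprojMk_arrow] using
    preprojMk_rel (PRel.arrow_zero (C := C) (sgn := sgn) i j hij)

lemma sum_pa_mul_pa (i : I) : ∑ j, sgn j i • (pa C sgn j i * pa C sgn i j) = 0 := by
  simpa only [map_sum, map_zsmul, map_mul, map_zero, preprojMk_arrow] using
    preprojMk_rel (PRel.preproj (C := C) (sgn := sgn) i)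

lemma pa_mul_pe (i j k : I) : pa C sgn i j * pe C sgn k = if i = k then pa C sgn i j else 0 := by
  rw [← pa_mul_pe_self, mul_assoc, pe_mul_pe]
  split_ifs <;> simp

lemma pe_mul_pa (i j k : I) : pe C sgn k * pa C sgn i j = if k = j then pa C sgn i j else 0 := by
  rw [← pe_mul_pa_self, ← mul_assoc, pe_mul_pe]
  split_ifs with h
  · rw [h]
  · simp

section Smul

variable {M : Type} [AddCommGroup M] [Module (PreprojAlg C sgn) M]

lemma pe_smul_pe_smul (i j : I) (x : M) :
    pe C sgn i • pe C sgn j • x = if i = j then pe C sgn i • x else 0 := by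
  rw [← mul_smul, pe_mul_pe]
  split_ifs <;> simp

lemma sum_pe_smul (x : M) : ∑ i, pe C sgn i • x = x := by
  rw [← Finset.sum_smul, sum_pe, one_smul]

lemma pa_smul_pe_smul (i j k : I) (x : M) :
    pa C sgn i j • pe C sgn k • x = if i = k then pa C sgn i j • x else 0 := by
  rw [← mul_smul, pa_mul_pe]
  split_ifs <;> simp

lemma pe_smul_pa_smul (i j k : I) (x : M) :
    pe C sgn k • pa C sgn i j • x = if k = j then pa C sgn i j • x else 0 := by
  rw [← mul_smul, pe_mul_pa]
  split_ifs <;> simp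

lemma sum_pa_smul_pa_smul (i : I) (x : M) :
    ∑ j, sgn j i • pa C sgn j i • pa C sgn i j • x = 0 := by
  simpa only [Finset.sum_smul, smul_assoc, mul_smul, zero_smul] using
    congr($(sum_pa_mul_pa C sgn i) • x)

end Smul

variable {C sgn}

/-- An intertwiner for the generators is an intertwiner for all of `Λ`. -/
lemma map_act_of_generators {V W : Type} [AddCommGroup V] [Module ℂ V]
    [AddCommGroup W] [Module ℂ W]
    (ρ : PreprojAlg C sgn →ₐ[ℂ] Module.End ℂ V) (τ : PreprojAlg C sgn →ₐ[ℂ] Module.End ℂ W)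
    (f : V →ₗ[ℂ] W)
    (he : ∀ i x, f (ρ (pe C sgn i) x) = τ (pe C sgn i) (f x))
    (ha : ∀ i j x, f (ρ (pa C sgn i j) x) = τ (pa C sgn i j) (f x))
    (r : PreprojAlg C sgn) (x : V) : f (ρ r x) = τ r (f x) := by
  obtain ⟨r, rfl⟩ : ∃ r', preprojMk C sgn r' = r :=
    RingQuot.mkAlgHom_surjective ℂ (PRel C sgn) r
  induction r using FreeAlgebra.induction generalizing x with
  | grade0 c => simp [Module.algebraMap_end_apply]
  | grade1 g =>
    cases g with
    | idem i => simpa only [preprojMk_idem] using he i x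
    | arrow i j => simpa only [preprojMk_arrow] using ha i j x
  | mul a b iha ihb => simp [iha, ihb]
  | add a b iha ihb => simp [iha, ihb]

/-- Operators satisfying the defining relations give a representation of `Λ`. -/
lemma exists_rep {V : Type} [AddCommGroup V] [Module ℂ V]
    (e : I → Module.End ℂ V) (a : I → I → Module.End ℂ V)
    (hee : ∀ i j, e i * e j = if i = j then e i else 0) (hsum : ∑ i, e i = 1)
    (hsrc : ∀ i j, a i j * e i = a i j) (htgt : ∀ i j, e j * a i j = a i j)
    (hzero : ∀ i j, C i j ≠ -1 → a i j = 0)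
    (hpre : ∀ i, ∑ j, sgn j i • (a j i * a i j) = 0) :
    ∃ ρ : PreprojAlg C sgn →ₐ[ℂ] Module.End ℂ V,
      (∀ i, ρ (pe C sgn i) = e i) ∧ ∀ i j, ρ (pa C sgn i j) = a i j := by
  let g : PGen I → Module.End ℂ V := fun x => match x with
    | .idem i => e i
    | .arrow i j => a i j
  have hrel : ∀ x y, PRel C sgn x y → FreeAlgebra.lift ℂ g x = FreeAlgebra.lift ℂ g y := by
    intro x y h
    induction h with
    | idem_mul i j =>
      rw [map_mul, apply_ite (FreeAlgebra.lift ℂ g), FreeAlgebra.lift_ι_apply,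
        FreeAlgebra.lift_ι_apply, map_zero]
      exact hee i j
    | idem_sum => simpa [g] using hsum
    | arrow_src i j => simpa [g] using hsrc i j
    | arrow_tgt i j => simpa [g] using htgt i j
    | arrow_zero i j h => simpa [g] using hzero i j h
    | preproj i => simpa [g] using hpre i
  let ρ : PreprojAlg C sgn →ₐ[ℂ] Module.End ℂ V :=
    RingQuot.liftAlgHom ℂ ⟨FreeAlgebra.lift ℂ g, fun {x y} h => hrel x y h⟩
  have key : ∀ x, ρ (RingQuot.mkRingHom (PRel C sgn) (FreeAlgebra.ι ℂ x)) = g x := by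
    intro x
    rw [← RingQuot.mkAlgHom_coe ℂ]
    exact (RingQuot.liftAlgHom_mkAlgHom_apply ℂ _ _ _).trans (FreeAlgebra.lift_ι_apply _ _)
  exact ⟨ρ, fun i => key _, fun i j => key _⟩

section Complex

set_option linter.unusedSectionVars false

variable (C sgn)
variable (X Y : Type)
  [AddCommGroup X] [Module (PreprojAlg C sgn) X] [Module ℂ X]
  [SMulCommClass (PreprojAlg C sgn) ℂ X]
  [AddCommGroup Y] [Module (PreprojAlg C sgn) Y] [Module ℂ Y]
  [SMulCommClass (PreprojAlg C sgn) ℂ Y]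

lemma smulIdem_apply (i : I) (x : X) : smulIdem C sgn X i x = pe C sgn i • x := rfl

lemma rangeRestrict_pe_smul (i : I) (x : X) :
    (smulIdem C sgn X i).rangeRestrict (pe C sgn i • x) =
      (smulIdem C sgn X i).rangeRestrict x := by
  apply Subtype.ext
  simp [LinearMap.rangeRestrict, smulIdem_apply, pe_smul_pe_smul]

/-- The linear maps `X → Y` supported on `e_i X → e_j Y`. -/
def homAt (i j : I) : Submodule ℂ (X →ₗ[ℂ] Y) where
  carrier := {g | ∀ x, pe C sgn j • g (pe C sgn i • x) = g x}
  add_mem' hf hg x := by simp [smul_add, hf x, hg x]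
  zero_mem' x := by simp
  smul_mem' c f hf x := by simp [smul_comm _ c, hf x]

/-- The linear maps `X → Y` supported on `e_i X → e_j Y` when `i` and `j` are adjacent,
and `0` otherwise. -/
def homArrow (i j : I) : Submodule ℂ (X →ₗ[ℂ] Y) where
  carrier := {g | g ∈ homAt C sgn X Y i j ∧ (C i j ≠ -1 → g = 0)}
  add_mem' hf hg := ⟨add_mem hf.1 hg.1, fun h => by rw [hf.2 h, hg.2 h, add_zero]⟩
  zero_mem' := ⟨zero_mem _, fun _ => rfl⟩
  smul_mem' c f hf := ⟨Submodule.smul_mem _ c hf.1, fun h => by rw [hf.2 h, smul_zero]⟩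

variable {C sgn X Y}

lemma homAt_apply_pe {i j : I} {g : X →ₗ[ℂ] Y} (hg : g ∈ homAt C sgn X Y i j) (k : I) (x : X) :
    g (pe C sgn k • x) = if i = k then g x else 0 := by
  rw [← hg, pe_smul_pe_smul]
  split_ifs
  · exact hg x
  · simp

lemma pe_smul_homAt_apply {i j : I} {g : X →ₗ[ℂ] Y} (hg : g ∈ homAt C sgn X Y i j) (k : I)
    (x : X) : pe C sgn k • g x = if k = j then g x else 0 := by
  rw [← hg, pe_smul_pe_smul]
  split_ifs with h
  · rw [h]
  · simp

lemma homArrow_apply_pe {i j : I} {g : X →ₗ[ℂ] Y} (hg : g ∈ homArrow C sgn X Y i j) (k : I)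
    (x : X) : g (pe C sgn k • x) = if i = k then g x else 0 :=
  homAt_apply_pe hg.1 k x

lemma pe_smul_homArrow_apply {i j : I} {g : X →ₗ[ℂ] Y} (hg : g ∈ homArrow C sgn X Y i j) (k : I)
    (x : X) : pe C sgn k • g x = if k = j then g x else 0 :=
  pe_smul_homAt_apply hg.1 k x

variable (C sgn X Y) in
/-- `e_j Hom(X, Y) e_i` is the space of linear maps `e_i X → e_j Y`. -/
def homAtEquiv (i j : I) : homAt C sgn X Y i j ≃ₗ[ℂ]
    (LinearMap.range (smulIdem C sgn X i) →ₗ[ℂ] LinearMap.range (smulIdem C sgn Y j)) where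
  toFun g := (smulIdem C sgn Y j).rangeRestrict ∘ₗ g.1 ∘ₗ Submodule.subtype _
  map_add' f g := by ext; simp
  map_smul' c f := by ext; simp
  invFun h := ⟨Submodule.subtype _ ∘ₗ h ∘ₗ (smulIdem C sgn X i).rangeRestrict, fun x => by
    obtain ⟨y, hy⟩ := (h ((smulIdem C sgn X i).rangeRestrict x)).2
    simp only [LinearMap.comp_apply, rangeRestrict_pe_smul, Submodule.subtype_apply, ← hy,
      smulIdem_apply, pe_smul_pe_smul, if_true]⟩
  left_inv g := by
    ext x
    simpa [smulIdem_apply] using g.2 x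
  right_inv h := by
    apply LinearMap.ext
    rintro ⟨_, x, rfl⟩
    apply Subtype.ext
    obtain ⟨y, hy⟩ := (h ((smulIdem C sgn X i).rangeRestrict x)).2
    change pe C sgn j • (h ((smulIdem C sgn X i).rangeRestrict (pe C sgn i • x))).1 =
      (h ((smulIdem C sgn X i).rangeRestrict x)).1
    simp only [rangeRestrict_pe_smul, ← hy, smulIdem_apply, pe_smul_pe_smul, if_true]

variable (C sgn X Y) in
/-- The degree-zero differential `f ↦ (f_j a - a f_i)_{a : i → j}`. -/
def dZero : (∀ i, homAt C sgn X Y i i) →ₗ[ℂ] ∀ p : I × I, homArrow C sgn X Y p.1 p.2 where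
  toFun f p := ⟨
    { toFun := fun x => (f p.2).1 (pa C sgn p.1 p.2 • x) - pa C sgn p.1 p.2 • (f p.1).1 x
      map_add' := fun x y => by simp only [smul_add, map_add]; abel
      map_smul' := fun c x => by simp [smul_comm _ c, smul_sub] },
    fun x => by
      simp [smul_sub, pa_smul_pe_smul, pe_smul_pa_smul, homAt_apply_pe (f p.1).2,
        pe_smul_homAt_apply (f p.2).2],
    fun h => by ext x; simp [pa_eq_zero C sgn h]⟩
  map_add' f g := by ext p x; simp only [Pi.add_apply, Submodule.coe_add, LinearMap.add_apply,
    LinearMap.coe_mk, AddHom.coe_mk, smul_add]; abel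
  map_smul' c f := by ext p x; simp [smul_comm _ c, smul_sub]

variable (C sgn X Y) in
/-- The degree-one differential, the linearisation of the preprojective relations. -/
def dOne : (∀ p : I × I, homArrow C sgn X Y p.1 p.2) →ₗ[ℂ] ∀ i, homAt C sgn X Y i i where
  toFun g i := ⟨
    { toFun := fun x => ∑ j, sgn j i •
        (pa C sgn j i • (g (i, j)).1 x + (g (j, i)).1 (pa C sgn i j • x))
      map_add' := fun x y => by
        simp only [smul_add, map_add, Finset.sum_add_distrib]; abel
      map_smul' := fun c x => by
        simp only [smul_comm _ c, map_smul, ← smul_add, Finset.smul_sum, RingHom.id_apply] },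
    fun x => by
      simp only [LinearMap.coe_mk, AddHom.coe_mk, Finset.smul_sum]
      refine Finset.sum_congr rfl fun j _ => ?_
      simp [smul_comm (pe C sgn i) (sgn j i), pa_smul_pe_smul, pe_smul_pa_smul,
        homArrow_apply_pe (g (i, j)).2, pe_smul_homArrow_apply (g (j, i)).2]⟩
  map_add' f g := by
    ext i x
    simp only [Pi.add_apply, Submodule.coe_add, LinearMap.add_apply,
      LinearMap.coe_mk, AddHom.coe_mk, smul_add, Finset.sum_add_distrib]
    abel
  map_smul' c f := by
    ext i x
    simp [smul_comm _ c, Finset.smul_sum]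

lemma dZero_apply (f : ∀ i, homAt C sgn X Y i i) (i j : I) (x : X) :
    (dZero C sgn X Y f (i, j)).1 x =
      (f j).1 (pa C sgn i j • x) - pa C sgn i j • (f i).1 x := rfl

lemma dOne_apply (g : ∀ p : I × I, homArrow C sgn X Y p.1 p.2) (i : I) (x : X) :
    (dOne C sgn X Y g i).1 x = ∑ j, sgn j i •
        (pa C sgn j i • (g (i, j)).1 x + (g (j, i)).1 (pa C sgn i j • x)) := rfl

variable (C sgn X Y) in
/-- The vertex components of a linear map. -/
def vertexPart (f : X →ₗ[ℂ] Y) (i : I) : homAt C sgn X Y i i :=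
  ⟨smulIdem C sgn Y i ∘ₗ f ∘ₗ smulIdem C sgn X i, fun x => by
    simp [smulIdem_apply, pe_smul_pe_smul]⟩

lemma vertexPart_apply {f : X →ₗ[ℂ] Y} (hf : ∀ k x, f (pe C sgn k • x) = pe C sgn k • f x)
    (i : I) (x : X) : (vertexPart C sgn X Y f i).1 x = pe C sgn i • f x := by
  simp [vertexPart, smulIdem_apply, hf, pe_smul_pe_smul]

lemma dZero_vertexPart {f : X →ₗ[ℂ] Y} (hf : ∀ k x, f (pe C sgn k • x) = pe C sgn k • f x)
    (i j : I) (x : X) : (dZero C sgn X Y (vertexPart C sgn X Y f) (i, j)).1 x =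
      f (pa C sgn i j • x) - pa C sgn i j • f x := by
  rw [dZero_apply, vertexPart_apply hf, vertexPart_apply hf, ← hf, pe_smul_pa_smul,
    pa_smul_pe_smul]
  simp

lemma sum_vertex_pe (f : ∀ i, homAt C sgn X Y i i) (k : I) (x : X) :
    (∑ i, (f i).1) (pe C sgn k • x) = (f k).1 x := by
  simp [homAt_apply_pe (f _).2]

lemma pe_smul_sum_vertex (f : ∀ i, homAt C sgn X Y i i) (k : I) (x : X) :
    pe C sgn k • (∑ i, (f i).1) x = (f k).1 x := by
  simp [Finset.smul_sum, pe_smul_homAt_apply (f _).2]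

lemma sum_vertex_graded (f : ∀ i, homAt C sgn X Y i i) (k : I) (x : X) :
    (∑ i, (f i).1) (pe C sgn k • x) = pe C sgn k • (∑ i, (f i).1) x := by
  rw [sum_vertex_pe, pe_smul_sum_vertex]

lemma vertexPart_sum (f : ∀ i, homAt C sgn X Y i i) :
    vertexPart C sgn X Y (∑ i, (f i).1) = f := by
  funext i
  apply Subtype.ext
  ext x
  rw [vertexPart_apply (sum_vertex_graded f), pe_smul_sum_vertex]

lemma dOne_dZero (f : ∀ i, homAt C sgn X Y i i) : dOne C sgn X Y (dZero C sgn X Y f) = 0 := by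
  funext i
  apply Subtype.ext
  ext x
  have hX := congr((f i).1 $(sum_pa_smul_pa_smul C sgn i x))
  rw [map_sum, map_zero] at hX
  have hY := sum_pa_smul_pa_smul C sgn i ((f i).1 x)
  rw [dOne_apply]
  calc _ = ∑ j, (f i).1 (sgn j i • pa C sgn j i • pa C sgn i j • x) -
        ∑ j, sgn j i • pa C sgn j i • pa C sgn i j • (f i).1 x := by
        rw [← Finset.sum_sub_distrib]
        refine Finset.sum_congr rfl fun j _ => ?_
        rw [dZero_apply, dZero_apply, map_zsmul, ← smul_sub, smul_sub]
        congr 1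
        abel
    _ = _ := by rw [hX, hY, sub_zero]; rfl

variable [FiniteDimensional ℂ X] [FiniteDimensional ℂ Y]

lemma finrank_homAt (i j : I) :
    finrank ℂ (homAt C sgn X Y i j) = dimv C sgn X i * dimv C sgn Y j := by
  rw [(homAtEquiv C sgn X Y i j).finrank_eq, Module.finrank_linearMap]
  rfl

lemma finrank_homArrow (i j : I) : finrank ℂ (homArrow C sgn X Y i j) =
    if C i j = -1 then dimv C sgn X i * dimv C sgn Y j else 0 := by
  split_ifs with h
  · have : homArrow C sgn X Y i j = homAt C sgn X Y i j :=
      le_antisymm (fun _ hg => hg.1) fun _ hg => ⟨hg, fun h' => absurd h h'⟩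
    rw [this, finrank_homAt]
  · have : homArrow C sgn X Y i j = ⊥ := (Submodule.eq_bot_iff _).2 fun g hg => hg.2 h
    rw [this, finrank_bot]


/-- If `tr (f ∘ k) = 0` for all `k ∈ e_i Hom(Y, X) e_j` then `f ∈ e_j Hom(X, Y) e_i` vanishes. -/
lemma homAt_eq_zero_of_trace {i j : I} {f : X →ₗ[ℂ] Y} (hf : f ∈ homAt C sgn X Y i j)
    (h : ∀ k ∈ homAt C sgn Y X j i, LinearMap.trace ℂ Y (f ∘ₗ k) = 0) : f = 0 := by
  ext x
  rw [LinearMap.zero_apply, ← Module.forall_dual_apply_eq_zero_iff ℂ]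
  intro ξ
  let k : Y →ₗ[ℂ] X := smulIdem C sgn X i ∘ₗ ξ.smulRight x ∘ₗ smulIdem C sgn Y j
  have hk : k ∈ homAt C sgn Y X j i := fun y => by
    simp [k, smulIdem, pe_smul_pe_smul, smul_comm (pe C sgn i) (ξ _)]
  have hfk : f ∘ₗ k = (ξ ∘ₗ smulIdem C sgn Y j).smulRight (f x) := by
    ext y
    simp [k, smulIdem, homAt_apply_pe hf, smul_comm (pe C sgn i) (ξ _)]
  have := h k hk
  rw [hfk, LinearMap.trace_smulRight] at this
  simpa [smulIdem_apply, pe_smul_homAt_apply hf] using this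

/-- Adjoint maps with respect to nondegenerate pairings have the same rank. -/
lemma finrank_range_eq_of_adjoint {U U' V V' : Type*}
    [AddCommGroup U] [Module ℂ U] [FiniteDimensional ℂ U]
    [AddCommGroup U'] [Module ℂ U'] [FiniteDimensional ℂ U']
    [AddCommGroup V] [Module ℂ V] [FiniteDimensional ℂ V]
    [AddCommGroup V'] [Module ℂ V'] [FiniteDimensional ℂ V']
    (D : U →ₗ[ℂ] V) (D' : V' →ₗ[ℂ] U') (βU : U →ₗ[ℂ] Dual ℂ U') (βV : V →ₗ[ℂ] Dual ℂ V')
    (hU : Function.Injective βU) (hV : Function.Injective βV)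
    (hfin : finrank ℂ U = finrank ℂ U') (h : ∀ u v', βV (D u) v' = βU u (D' v')) :
    finrank ℂ (LinearMap.range D) = finrank ℂ (LinearMap.range D') := by
  have hcomp : βV ∘ₗ D = D'.dualMap ∘ₗ βU := by
    ext u v'
    exact h u v'
  have hsurj : LinearMap.range βU = ⊤ := LinearMap.range_eq_top.2
    ((LinearMap.injective_iff_surjective_of_finrank_eq_finrank
      (hfin.trans Subspace.dual_finrank_eq.symm)).1 hU)
  rw [← LinearMap.finrank_range_dualMap_eq_finrank_range D', ← LinearMap.range_comp_of_range_eq_top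
    _ hsurj, ← hcomp, LinearMap.range_comp]
  exact (LinearEquiv.finrank_eq (Submodule.equivMapOfInjective βV hV _))

variable (C sgn X) in
/-- The ℂ-linear action of the arrow `i → j` on a `Λ`-module. -/
def smulArrow (i j : I) : X →ₗ[ℂ] X where
  toFun x := pa C sgn i j • x
  map_add' x y := smul_add _ x y
  map_smul' c x := smul_comm _ c x

lemma dZero_eq (f : ∀ i, homAt C sgn X Y i i) (i j : I) :
    (dZero C sgn X Y f (i, j)).1 =
      (f j).1 ∘ₗ smulArrow C sgn X i j - smulArrow C sgn Y i j ∘ₗ (f i).1 := rfl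

lemma dOne_eq (g : ∀ p : I × I, homArrow C sgn X Y p.1 p.2) (i : I) :
    (dOne C sgn X Y g i).1 = ∑ j, sgn j i • (smulArrow C sgn Y j i ∘ₗ (g (i, j)).1 +
      (g (j, i)).1 ∘ₗ smulArrow C sgn X i j) := by
  ext x
  rw [dOne_apply, LinearMap.sum_apply]
  rfl

variable (C sgn X Y) in
/-- The trace pairing on vertex-supported maps. -/
def pairVertex : (∀ i, homAt C sgn X Y i i) →ₗ[ℂ] Dual ℂ (∀ i, homAt C sgn Y X i i) :=
  LinearMap.mk₂ ℂ (fun f h => ∑ i, LinearMap.trace ℂ Y ((f i).1 ∘ₗ (h i).1))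
    (fun f f' h => by simp [LinearMap.add_comp, Finset.sum_add_distrib])
    (fun c f h => by simp [LinearMap.smul_comp, Finset.mul_sum])
    (fun f h h' => by simp [LinearMap.comp_add, Finset.sum_add_distrib])
    (fun c f h => by simp [LinearMap.comp_smul, Finset.mul_sum])

variable (C sgn X Y) in
/-- The signed trace pairing on arrow-supported maps. -/
def pairArrow : (∀ p : I × I, homArrow C sgn X Y p.1 p.2) →ₗ[ℂ]
    Dual ℂ (∀ p : I × I, homArrow C sgn Y X p.1 p.2) :=
  LinearMap.mk₂ ℂ (fun g k => ∑ i, ∑ j, (sgn j i : ℂ) *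
      LinearMap.trace ℂ Y ((g (i, j)).1 ∘ₗ (k (j, i)).1))
    (fun f f' h => by simp [LinearMap.add_comp, Finset.sum_add_distrib, mul_add])
    (fun c f h => by simp [LinearMap.smul_comp, Finset.mul_sum, mul_left_comm])
    (fun f h h' => by simp [LinearMap.comp_add, Finset.sum_add_distrib, mul_add])
    (fun c f h => by simp [LinearMap.comp_smul, Finset.mul_sum, mul_left_comm])

lemma pairVertex_apply (f : ∀ i, homAt C sgn X Y i i) (h : ∀ i, homAt C sgn Y X i i) :
    pairVertex C sgn X Y f h = ∑ i, LinearMap.trace ℂ Y ((f i).1 ∘ₗ (h i).1) := rfl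

lemma pairArrow_apply (g : ∀ p : I × I, homArrow C sgn X Y p.1 p.2)
    (k : ∀ p : I × I, homArrow C sgn Y X p.1 p.2) :
    pairArrow C sgn X Y g k = ∑ i, ∑ j, (sgn j i : ℂ) *
      LinearMap.trace ℂ Y ((g (i, j)).1 ∘ₗ (k (j, i)).1) := rfl

lemma pairVertex_injective : Function.Injective (pairVertex C sgn X Y) := by
  rw [injective_iff_map_eq_zero]
  intro f hf
  funext i
  apply Subtype.ext
  refine homAt_eq_zero_of_trace (f i).2 fun k hk => ?_
  have := congr($hf (Pi.single i ⟨k, hk⟩))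
  rw [pairVertex_apply, Finset.sum_eq_single i] at this
  · simpa using this
  · intro j _ hj
    simp [Pi.single_eq_of_ne hj]
  · simp

lemma pairArrow_injective (hsym : ∀ i j, C i j = C j i)
    (hsgn : ∀ i j, C i j = -1 → sgn i j ≠ 0) :
    Function.Injective (pairArrow C sgn X Y) := by
  rw [injective_iff_map_eq_zero]
  intro g hg
  funext ⟨i, j⟩
  apply Subtype.ext
  by_cases hij : C i j = -1
  · refine homAt_eq_zero_of_trace (g (i, j)).2.1 fun k hk => ?_
    have hk' : k ∈ homArrow C sgn Y X j i := ⟨hk, fun h => absurd ((hsym j i).trans hij) h⟩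
    have := congr($hg (Pi.single (j, i) ⟨k, hk'⟩))
    rw [pairArrow_apply, Finset.sum_eq_single i, Finset.sum_eq_single j] at this
    · simpa [hsgn j i ((hsym j i).trans hij)] using this
    · intro j' _ hj
      have : ((j', i) : I × I) ≠ (j, i) := fun h => hj (congrArg Prod.fst h)
      simp [Pi.single_eq_of_ne this]
    · simp
    · intro i' _ hi
      refine Finset.sum_eq_zero fun j' _ => ?_
      have : ((j', i') : I × I) ≠ (j, i) := fun h => hi (congrArg Prod.snd h)
      simp [Pi.single_eq_of_ne this]
    · simp
  · exact (g (i, j)).2.2 hij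

/-- The two differentials are adjoint for the trace pairings. -/
lemma pairVertex_dOne (hsgn : ∀ i j, C i j = -1 → sgn i j = -sgn j i)
    (g : ∀ p : I × I, homArrow C sgn X Y p.1 p.2) (h : ∀ i, homAt C sgn Y X i i) :
    pairVertex C sgn X Y (dOne C sgn X Y g) h = pairArrow C sgn X Y g (dZero C sgn Y X h) := by
  have key : ∀ i j, (sgn i j : ℂ) * LinearMap.trace ℂ Y
      ((g (i, j)).1 ∘ₗ smulArrow C sgn X j i ∘ₗ (h j).1) = -((sgn j i : ℂ) * LinearMap.trace ℂ Y
      ((g (i, j)).1 ∘ₗ smulArrow C sgn X j i ∘ₗ (h j).1)) := by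
    intro i j
    by_cases hij : C i j = -1
    · simp [hsgn i j hij]
    · simp [(g (i, j)).2.2 hij]
  have lhs : pairVertex C sgn X Y (dOne C sgn X Y g) h =
      ∑ i, ∑ j, (sgn j i : ℂ) * LinearMap.trace ℂ Y
        (smulArrow C sgn Y j i ∘ₗ (g (i, j)).1 ∘ₗ (h i).1) +
      ∑ i, ∑ j, (sgn j i : ℂ) * LinearMap.trace ℂ Y
        ((g (j, i)).1 ∘ₗ smulArrow C sgn X i j ∘ₗ (h i).1) := by
    rw [pairVertex_apply, ← Finset.sum_add_distrib]
    refine Finset.sum_congr rfl fun i _ => ?_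
    rw [dOne_eq, ← LinearMap.lcomp_apply' (S := ℂ), map_sum, map_sum, ← Finset.sum_add_distrib]
    refine Finset.sum_congr rfl fun j _ => ?_
    rw [LinearMap.lcomp_apply', ← Int.cast_smul_eq_zsmul ℂ, LinearMap.smul_comp, map_smul, LinearMap.add_comp, map_add,
      smul_eq_mul, mul_add, LinearMap.comp_assoc, LinearMap.comp_assoc]
  have swap : ∑ i, ∑ j, (sgn j i : ℂ) * LinearMap.trace ℂ Y
        ((g (j, i)).1 ∘ₗ smulArrow C sgn X i j ∘ₗ (h i).1) =
      ∑ i, ∑ j, (sgn i j : ℂ) * LinearMap.trace ℂ Y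
        ((g (i, j)).1 ∘ₗ smulArrow C sgn X j i ∘ₗ (h j).1) := Finset.sum_comm
  rw [lhs, swap, pairArrow_apply, ← Finset.sum_add_distrib]
  refine Finset.sum_congr rfl fun i _ => ?_
  rw [← Finset.sum_add_distrib]
  refine Finset.sum_congr rfl fun j _ => ?_
  rw [key, dZero_eq, LinearMap.comp_sub, map_sub, LinearMap.trace_comp_comm', mul_sub,
    LinearMap.comp_assoc, sub_eq_add_neg]

lemma finrank_vertex : finrank ℂ (∀ i, homAt C sgn X Y i i) =
    ∑ i, dimv C sgn X i * dimv C sgn Y i := by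
  simp_rw [Module.finrank_pi_fintype, finrank_homAt]

lemma finrank_arrow : finrank ℂ (∀ p : I × I, homArrow C sgn X Y p.1 p.2) =
    ∑ i, ∑ j, if C i j = -1 then dimv C sgn X i * dimv C sgn Y j else 0 := by
  simp_rw [Module.finrank_pi_fintype, finrank_homArrow, Fintype.sum_prod_type]

lemma finrank_range_dOne (hsym : ∀ i j, C i j = C j i)
    (hsgn : ∀ i j, C i j = -1 → sgn i j ≠ 0 ∧ sgn i j = -sgn j i) :
    finrank ℂ (LinearMap.range (dOne C sgn X Y)) =
      finrank ℂ (LinearMap.range (dZero C sgn Y X)) := by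
  refine finrank_range_eq_of_adjoint _ _ (pairArrow C sgn X Y) (pairVertex C sgn X Y)
    (pairArrow_injective hsym fun i j h => (hsgn i j h).1) pairVertex_injective ?_
    (pairVertex_dOne fun i j h => (hsgn i j h).2)
  rw [finrank_arrow, finrank_arrow, Finset.sum_comm]
  simp_rw [hsym, mul_comm]

end Complex

section Linearity

variable {M N : Type}
  [AddCommGroup M] [Module (PreprojAlg C sgn) M] [Module ℂ M]
  [IsScalarTower ℂ (PreprojAlg C sgn) M]
  [AddCommGroup N] [Module (PreprojAlg C sgn) N] [Module ℂ N]
  [IsScalarTower ℂ (PreprojAlg C sgn) N]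

/-- A ℂ-linear map commuting with the generators is `Λ`-linear. -/
def linearMapOfGenerators (f : M →ₗ[ℂ] N)
    (he : ∀ i x, f (pe C sgn i • x) = pe C sgn i • f x)
    (ha : ∀ i j x, f (pa C sgn i j • x) = pa C sgn i j • f x) : M →ₗ[PreprojAlg C sgn] N where
  toFun := f
  map_add' := map_add f
  map_smul' r x := map_act_of_generators (Algebra.lsmul ℂ ℂ M) (Algebra.lsmul ℂ ℂ N) f he ha r x

lemma linearMapOfGenerators_apply (f : M →ₗ[ℂ] N)
    (he : ∀ i x, f (pe C sgn i • x) = pe C sgn i • f x)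
    (ha : ∀ i j x, f (pa C sgn i j • x) = pa C sgn i j • f x) (x : M) :
    linearMapOfGenerators f he ha x = f x := rfl

/-- `Hom_Λ(M, N)` is the kernel of the degree-zero differential. -/
def homEquivKer : (M →ₗ[PreprojAlg C sgn] N) ≃ₗ[ℂ] LinearMap.ker (dZero C sgn M N) where
  toFun φ := ⟨vertexPart C sgn M N (φ.restrictScalars ℂ), by
    rw [LinearMap.mem_ker]
    funext ⟨i, j⟩
    apply Subtype.ext
    ext x
    rw [dZero_vertexPart (fun k x => by simp)]
    simp⟩
  map_add' φ ψ := by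
    apply Subtype.ext
    funext i
    apply Subtype.ext
    ext x
    simp [vertexPart]
  map_smul' c φ := by
    apply Subtype.ext
    funext i
    apply Subtype.ext
    ext x
    simp [vertexPart]
  invFun f := linearMapOfGenerators (∑ i, (f.1 i).1) (sum_vertex_graded f.1) fun i j x => by
    have := congr(($(f.2) (i, j)).1 x)
    rw [← vertexPart_sum f.1, dZero_vertexPart (sum_vertex_graded f.1)] at this
    exact sub_eq_zero.1 this
  left_inv φ := by
    ext x
    rw [linearMapOfGenerators_apply, LinearMap.sum_apply, ← sum_pe_smul C sgn (φ x)]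
    exact Finset.sum_congr rfl fun i _ => vertexPart_apply (fun k x => by simp) i x
  right_inv f := Subtype.ext (vertexPart_sum f.1)

end Linearity

section Presentation

set_option linter.unusedSectionVars false

variable {X Y K P : Type}
  [AddCommGroup X] [Module (PreprojAlg C sgn) X] [Module ℂ X]
  [IsScalarTower ℂ (PreprojAlg C sgn) X]
  [AddCommGroup Y] [Module (PreprojAlg C sgn) Y] [Module ℂ Y]
  [IsScalarTower ℂ (PreprojAlg C sgn) Y]
  [AddCommGroup K] [Module (PreprojAlg C sgn) K] [Module ℂ K]
  [IsScalarTower ℂ (PreprojAlg C sgn) K]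
  [AddCommGroup P] [Module (PreprojAlg C sgn) P] [Module ℂ P]
  [IsScalarTower ℂ (PreprojAlg C sgn) P]

/-- A splitting of `0 → K → P → X → 0` over the semisimple subalgebra spanned by the
vertex idempotents. -/
structure VertexSplitting (ι : K →ₗ[PreprojAlg C sgn] P) (π : P →ₗ[PreprojAlg C sgn] X) where
  /-- The section of `π`. -/
  s : X →ₗ[ℂ] P
  /-- The retraction of `ι`. -/
  t : P →ₗ[ℂ] K
  s_pe : ∀ k x, s (pe C sgn k • x) = pe C sgn k • s x
  t_pe : ∀ k x, t (pe C sgn k • x) = pe C sgn k • t x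
  π_s : ∀ x, π (s x) = x
  ι_t : ∀ p, ι (t p) = p - s (π p)
  t_ι : ∀ k, t (ι k) = k
  π_ι : ∀ k, π (ι k) = 0

lemma nonempty_vertexSplitting (ι : K →ₗ[PreprojAlg C sgn] P) (π : P →ₗ[PreprojAlg C sgn] X)
    (hι : Function.Injective ι) (hπ : Function.Surjective π)
    (hex : LinearMap.range ι = LinearMap.ker π) : Nonempty (VertexSplitting ι π) := by
  obtain ⟨s₀, hs₀⟩ := (π.restrictScalars ℂ).exists_rightInverse_of_surjective
    (LinearMap.range_eq_top.2 hπ)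
  have hs₀' : ∀ x, π (s₀ x) = x := fun x => congr($hs₀ x)
  let s : X →ₗ[ℂ] P := ∑ i, smulIdem C sgn P i ∘ₗ s₀ ∘ₗ smulIdem C sgn X i
  have hs : ∀ x, s x = ∑ i, pe C sgn i • s₀ (pe C sgn i • x) := fun x => by
    simp [s, smulIdem_apply]
  have s_pe : ∀ k x, s (pe C sgn k • x) = pe C sgn k • s x := fun k x => by
    rw [hs, hs, Finset.smul_sum, Finset.sum_eq_single k, Finset.sum_eq_single k]
    · simp [pe_smul_pe_smul]
    · intro i _ hi
      simp [pe_smul_pe_smul, hi.symm]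
    · simp
    · intro i _ hi
      simp [pe_smul_pe_smul, hi]
    · simp
  have π_s : ∀ x, π (s x) = x := fun x => by
    rw [hs, map_sum]
    simp [hs₀', pe_smul_pe_smul, sum_pe_smul]
  have π_ι : ∀ k, π (ι k) = 0 := fun k => by
    rw [← LinearMap.mem_ker, ← hex]
    exact ⟨k, rfl⟩
  have hker : ∀ p, ∃ k, ι k = p - s (π p) := fun p => by
    rw [← LinearMap.mem_range, hex, LinearMap.mem_ker, map_sub, π_s, sub_self]
  choose t ht using hker
  have ι_smul : ∀ (c : ℂ) k, ι (c • k) = c • ι k := (ι.restrictScalars ℂ).map_smul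
  have π_smul : ∀ (c : ℂ) k, π (c • k) = c • π k := (π.restrictScalars ℂ).map_smul
  exact ⟨{
    s := s
    t :=
      { toFun := t
        map_add' := fun x y => hι (by simp only [ht, map_add]; abel)
        map_smul' := fun c x => hι (by simp [ht, ι_smul, π_smul, smul_sub]) }
    s_pe := s_pe
    t_pe := fun k x => hι (by
      change ι (t _) = ι (_ • t _)
      rw [map_smul, ht, ht, map_smul, s_pe, smul_sub])
    π_s := π_s
    ι_t := ht
    t_ι := fun k => hι (by
      change ι (t _) = _
      rw [ht, π_ι, map_zero, sub_zero])
    π_ι := π_ι }⟩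

namespace VertexSplitting

variable {ι : K →ₗ[PreprojAlg C sgn] P} {π : P →ₗ[PreprojAlg C sgn] X}
  (σ : VertexSplitting ι π)

/-- The cocycle of the pushout along `φ` of an extension. -/
def cocycle : (K →ₗ[PreprojAlg C sgn] Y) →ₗ[ℂ] ∀ p : I × I, homArrow C sgn X Y p.1 p.2 where
  toFun φ p := ⟨φ.restrictScalars ℂ ∘ₗ σ.t ∘ₗ smulArrow C sgn P p.1 p.2 ∘ₗ σ.s, by
    constructor
    · intro x
      change pe C sgn p.2 • φ (σ.t (pa C sgn p.1 p.2 • σ.s (pe C sgn p.1 • x))) =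
        φ (σ.t (pa C sgn p.1 p.2 • σ.s x))
      rw [← map_smul, ← σ.t_pe, pe_smul_pa_smul, σ.s_pe, pa_smul_pe_smul]
      simp
    · intro h
      ext x
      change φ (σ.t (pa C sgn p.1 p.2 • σ.s x)) = 0
      simp [pa_eq_zero C sgn h]⟩
  map_add' φ ψ := rfl
  map_smul' c φ := rfl

lemma cocycle_apply (φ : K →ₗ[PreprojAlg C sgn] Y) (i j : I) (x : X) :
    (σ.cocycle φ (i, j)).1 x = φ (σ.t (pa C sgn i j • σ.s x)) := rfl

lemma ι_injective (σ : VertexSplitting ι π) : Function.Injective ι := fun k k' h => by rw [← σ.t_ι k, h, σ.t_ι]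

lemma dOne_cocycle (φ : K →ₗ[PreprojAlg C sgn] Y) :
    dOne C sgn X Y (σ.cocycle φ) = 0 := by
  funext i
  apply Subtype.ext
  ext x
  have key : ∑ j, sgn j i • (pa C sgn j i • σ.t (pa C sgn i j • σ.s x) +
      σ.t (pa C sgn j i • σ.s (pa C sgn i j • x))) = 0 := by
    apply σ.ι_injective
    have hX := congr(σ.s $(sum_pa_smul_pa_smul C sgn i x))
    rw [map_sum, map_zero] at hX
    rw [map_sum, map_zero]
    calc _ = ∑ j, sgn j i • pa C sgn j i • pa C sgn i j • σ.s x -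
          ∑ j, σ.s (sgn j i • pa C sgn j i • pa C sgn i j • x) := by
          rw [← Finset.sum_sub_distrib]
          refine Finset.sum_congr rfl fun j _ => ?_
          rw [map_zsmul, map_zsmul, ← smul_sub, map_add, map_smul ι, σ.ι_t, σ.ι_t, map_smul π,
            map_smul π, σ.π_s, σ.π_s, smul_sub]
          congr 1
          abel
      _ = 0 := by rw [hX, sum_pa_smul_pa_smul, sub_zero]
  have := congr(φ $key)
  rw [map_sum, map_zero] at this
  rw [dOne_apply]
  refine Eq.trans (Finset.sum_congr rfl fun j _ => ?_) this
  rw [map_zsmul, map_add, map_smul φ, cocycle_apply, cocycle_apply]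

lemma t_pa_smul (i j : I) (p : P) : σ.t (pa C sgn i j • p) =
    pa C sgn i j • σ.t p + σ.t (pa C sgn i j • σ.s (π p)) := by
  apply σ.ι_injective
  rw [map_add, map_smul ι, σ.ι_t, σ.ι_t, σ.ι_t, map_smul π, map_smul π, σ.π_s, smul_sub]
  abel

lemma cocycle_mem_range_iff (φ : K →ₗ[PreprojAlg C sgn] Y) :
    σ.cocycle φ ∈ LinearMap.range (dZero C sgn X Y) ↔
      φ ∈ LinearMap.range (precomp (M := Y) ι) := by
  constructor
  · rintro ⟨f, hf⟩
    let F : X →ₗ[ℂ] Y := ∑ i, (f i).1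
    have hF : ∀ k x, F (pe C sgn k • x) = pe C sgn k • F x := sum_vertex_graded f
    have hFa : ∀ i j x, φ (σ.t (pa C sgn i j • σ.s x)) =
        F (pa C sgn i j • x) - pa C sgn i j • F x := fun i j x => by
      rw [← dZero_vertexPart hF, vertexPart_sum, hf, cocycle_apply]
    let ψ : P →ₗ[ℂ] Y := φ.restrictScalars ℂ ∘ₗ σ.t - F ∘ₗ π.restrictScalars ℂ
    have hψ : ∀ p, ψ p = φ (σ.t p) - F (π p) := fun p => rfl
    refine ⟨linearMapOfGenerators ψ (fun i p => ?_) fun i j p => ?_, ?_⟩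
    · rw [hψ, hψ, σ.t_pe, map_smul, map_smul, hF, smul_sub]
    · rw [hψ, hψ, t_pa_smul, map_add, hFa, map_smul φ, map_smul π, smul_sub]
      abel
    · ext k
      change ψ (ι k) = φ k
      rw [hψ, σ.t_ι, σ.π_ι, map_zero, sub_zero]
  · rintro ⟨ψ, rfl⟩
    have hg : ∀ k x, (-(ψ.restrictScalars ℂ ∘ₗ σ.s)) (pe C sgn k • x) =
        pe C sgn k • (-(ψ.restrictScalars ℂ ∘ₗ σ.s)) x := fun k x => by
      simp [σ.s_pe]
    refine ⟨vertexPart C sgn X Y (-(ψ.restrictScalars ℂ ∘ₗ σ.s)), ?_⟩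
    funext ⟨i, j⟩
    apply Subtype.ext
    ext x
    rw [dZero_vertexPart hg, cocycle_apply]
    change _ = ψ (ι _)
    rw [σ.ι_t, map_smul π, σ.π_s, map_sub, map_smul ψ]
    simp only [LinearMap.neg_apply, LinearMap.comp_apply, LinearMap.restrictScalars_apply,
      smul_neg]
    abel

end VertexSplitting

/-- Lifting along a surjection from a representation of `Λ` given by an algebra map. -/
lemma exists_lift_rep (hP : Module.Projective (PreprojAlg C sgn) P)
    (π : P →ₗ[PreprojAlg C sgn] X) {V : Type} [AddCommGroup V] [Module ℂ V]
    (ρ : PreprojAlg C sgn →ₐ[ℂ] Module.End ℂ V) (q : V →ₗ[ℂ] X) (hq : Function.Surjective q)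
    (hqρ : ∀ r v, q (ρ r v) = r • q v) :
    ∃ u : P →ₗ[ℂ] V, (∀ r p, u (r • p) = ρ r (u p)) ∧ ∀ p, q (u p) = π p := by
  let : Module (PreprojAlg C sgn) V := Module.compHom V ρ.toRingHom
  let q' : V →ₗ[PreprojAlg C sgn] X := { toFun := q, map_add' := map_add q, map_smul' := hqρ }
  obtain ⟨h, hh⟩ := Module.projective_lifting_property q' π hq
  refine ⟨{ toFun := h, map_add' := map_add h, map_smul' := fun c p => ?_ },
    fun r p => map_smul h r p, fun p => congr($hh p)⟩
  rw [← algebraMap_smul (PreprojAlg C sgn) c p, map_smul]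
  change ρ (algebraMap ℂ _ c) (h p) = _
  rw [AlgHom.commutes]
  rfl

/-- The extension of `X` by `Y` defined by a cocycle. -/
lemma exists_extension_rep (g : ∀ p : I × I, homArrow C sgn X Y p.1 p.2)
    (hg : dOne C sgn X Y g = 0) :
    ∃ ρ : PreprojAlg C sgn →ₐ[ℂ] Module.End ℂ (Y × X),
      (∀ i v, ρ (pe C sgn i) v = (pe C sgn i • v.1, pe C sgn i • v.2)) ∧
      ∀ i j v, ρ (pa C sgn i j) v =
        (pa C sgn i j • v.1 + (g (i, j)).1 v.2, pa C sgn i j • v.2) := by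
  let e : I → Module.End ℂ (Y × X) := fun i => (smulIdem C sgn Y i).prodMap (smulIdem C sgn X i)
  let a : I → I → Module.End ℂ (Y × X) := fun i j =>
    (smulArrow C sgn Y i j ∘ₗ LinearMap.fst ℂ Y X + (g (i, j)).1 ∘ₗ LinearMap.snd ℂ Y X).prod
      (smulArrow C sgn X i j ∘ₗ LinearMap.snd ℂ Y X)
  have he : ∀ i v, e i v = (pe C sgn i • v.1, pe C sgn i • v.2) := fun i v => rfl
  have ha : ∀ i j v, a i j v =
    (pa C sgn i j • v.1 + (g (i, j)).1 v.2, pa C sgn i j • v.2) := fun i j v => rfl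
  obtain ⟨ρ, hρe, hρa⟩ := exists_rep (C := C) (sgn := sgn) e a
    (fun i j => LinearMap.ext fun v => by
      rw [Module.End.mul_apply, he, he, pe_smul_pe_smul, pe_smul_pe_smul]
      split_ifs <;> simp [he])
    (LinearMap.ext fun v => by
      rw [LinearMap.sum_apply]
      ext
      · simp [he, Prod.fst_sum, sum_pe_smul]
      · simp [he, Prod.snd_sum, sum_pe_smul])
    (fun i j => LinearMap.ext fun v => by
      simp [ha, he, pa_smul_pe_smul, homArrow_apply_pe (g (i, j)).2])
    (fun i j => LinearMap.ext fun v => by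
      simp [ha, he, pe_smul_pa_smul, pe_smul_homArrow_apply (g (i, j)).2])
    (fun i j h => LinearMap.ext fun v => by
      simp [ha, pa_eq_zero C sgn h, (g (i, j)).2.2 h])
    (fun i => LinearMap.ext fun v => by
      have hv : ∀ j, (sgn j i • (a j i * a i j)) v = sgn j i • a j i (a i j v) := fun _ => rfl
      have hgi : (dOne C sgn X Y g i).1 v.2 = 0 := by rw [hg]; rfl
      rw [dOne_apply] at hgi
      rw [LinearMap.sum_apply]
      simp only [hv, ha]
      ext
      · rw [Prod.fst_sum]
        calc _ = ∑ j, sgn j i • pa C sgn j i • pa C sgn i j • v.1 + ∑ j, sgn j i •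
              (pa C sgn j i • (g (i, j)).1 v.2 + (g (j, i)).1 (pa C sgn i j • v.2)) := by
              rw [← Finset.sum_add_distrib]
              refine Finset.sum_congr rfl fun j _ => ?_
              rw [Prod.smul_fst, ← smul_add, smul_add (pa C sgn j i), add_assoc]
          _ = _ := by rw [sum_pa_smul_pa_smul, hgi, add_zero]; rfl
      · rw [Prod.snd_sum]
        exact sum_pa_smul_pa_smul C sgn i v.2)
  exact ⟨ρ, fun i v => by rw [hρe, he], fun i j v => by rw [hρa, ha]⟩

namespace VertexSplitting

variable {ι : K →ₗ[PreprojAlg C sgn] P} {π : P →ₗ[PreprojAlg C sgn] X}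
  (σ : VertexSplitting ι π)

lemma exists_cocycle_sub_mem_range (hP : Module.Projective (PreprojAlg C sgn) P)
    (g : ∀ p : I × I, homArrow C sgn X Y p.1 p.2) (hg : dOne C sgn X Y g = 0) :
    ∃ φ : K →ₗ[PreprojAlg C sgn] Y, σ.cocycle φ - g ∈ LinearMap.range (dZero C sgn X Y) := by
  obtain ⟨ρ, hρe, hρa⟩ := exists_extension_rep g hg
  obtain ⟨u, hu, hπu⟩ := exists_lift_rep hP π ρ (LinearMap.snd ℂ Y X) LinearMap.snd_surjective
    (fun r v => map_act_of_generators ρ (Algebra.lsmul ℂ ℂ X) (LinearMap.snd ℂ Y X)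
      (fun i v => by rw [hρe]; rfl) (fun i j v => by rw [hρa]; rfl) r v)
  let w : P →ₗ[ℂ] Y := LinearMap.fst ℂ Y X ∘ₗ u
  have hwe : ∀ i p, w (pe C sgn i • p) = pe C sgn i • w p := fun i p => by
    simp [w, hu, hρe]
  have hwa : ∀ i j p, w (pa C sgn i j • p) = pa C sgn i j • w p + (g (i, j)).1 (π p) :=
    fun i j p => by
      rw [← hπu]
      simp [w, hu, hρa]
  let φ : K →ₗ[PreprojAlg C sgn] Y := linearMapOfGenerators (w ∘ₗ ι.restrictScalars ℂ)
    (fun i k => by simp [hwe]) (fun i j k => by simp [hwa, σ.π_ι])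
  have hφ : ∀ k, φ k = w (ι k) := fun k => rfl
  have hws : ∀ k x, (-(w ∘ₗ σ.s)) (pe C sgn k • x) = pe C sgn k • (-(w ∘ₗ σ.s)) x :=
    fun k x => by simp [σ.s_pe, hwe]
  refine ⟨φ, vertexPart C sgn X Y (-(w ∘ₗ σ.s)), ?_⟩
  funext ⟨i, j⟩
  apply Subtype.ext
  ext x
  rw [dZero_vertexPart hws]
  change _ = (σ.cocycle φ (i, j)).1 x - (g (i, j)).1 x
  rw [cocycle_apply, hφ, σ.ι_t, map_smul π, σ.π_s, map_sub, hwa, σ.π_s]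
  simp only [LinearMap.neg_apply, LinearMap.comp_apply, smul_neg]
  abel

variable [FiniteDimensional ℂ X] [FiniteDimensional ℂ Y]

/-- `Ext¹` is the middle cohomology of the complex `dZero`, `dOne`. -/
lemma ext1dim_add (σ : VertexSplitting ι π) (hP : Module.Projective (PreprojAlg C sgn) P) :
    ext1dim ι Y + finrank ℂ (LinearMap.range (dZero C sgn X Y)) +
        finrank ℂ (LinearMap.range (dOne C sgn X Y)) =
      finrank ℂ (∀ p : I × I, homArrow C sgn X Y p.1 p.2) := by
  set R := LinearMap.range (dZero C sgn X Y) with hR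
  have hle : R ≤ LinearMap.ker (dOne C sgn X Y) := by
    rintro _ ⟨f, rfl⟩
    exact dOne_dZero f
  let Φ : (K →ₗ[PreprojAlg C sgn] Y) →ₗ[ℂ] _ := R.mkQ ∘ₗ σ.cocycle
  have hker : LinearMap.ker Φ = LinearMap.range (precomp (M := Y) ι) := by
    ext φ
    rw [LinearMap.mem_ker, LinearMap.comp_apply, Submodule.mkQ_apply, Submodule.Quotient.mk_eq_zero,
      cocycle_mem_range_iff]
  have hrange : LinearMap.range Φ = LinearMap.ker (R.liftQ (dOne C sgn X Y) hle) := by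
    rw [Submodule.ker_liftQ]
    apply le_antisymm
    · rintro _ ⟨φ, rfl⟩
      exact ⟨σ.cocycle φ, σ.dOne_cocycle φ, rfl⟩
    · rintro _ ⟨g, hg, rfl⟩
      obtain ⟨φ, hφ⟩ := σ.exists_cocycle_sub_mem_range hP g hg
      exact ⟨φ, (Submodule.Quotient.eq R).2 hφ⟩
  have hext : ext1dim ι Y = finrank ℂ (LinearMap.ker (R.liftQ (dOne C sgn X Y) hle)) := by
    rw [ext1dim, ← hker, Φ.quotKerEquivRange.finrank_eq, hrange]
  have h1 := LinearMap.finrank_range_add_finrank_ker (R.liftQ (dOne C sgn X Y) hle)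
  have h2 := Submodule.finrank_quotient_add_finrank R
  rw [Submodule.range_liftQ] at h1
  omega

end VertexSplitting

variable [FiniteDimensional ℂ X] [FiniteDimensional ℂ Y]

lemma cartan_form_eq (hdiag : ∀ i, C i i = 2)
    (hoff : ∀ i j, i ≠ j → C i j = 0 ∨ C i j = -1) (v w : I → ℕ) :
    ∑ i, ∑ k, (v i : ℤ) * (w k : ℤ) * C i k =
      2 * ((∑ i, v i * w i : ℕ) : ℤ) -
        ((∑ i, ∑ j, if C i j = -1 then v i * w j else 0 : ℕ) : ℤ) := by
  have hC : ∀ i k, (v i : ℤ) * (w k : ℤ) * C i k = (if i = k then 2 * ((v i : ℤ) * w k) else 0) -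
      ((if C i k = -1 then v i * w k else 0 : ℕ) : ℤ) := by
    intro i k
    by_cases h : i = k
    · subst h
      simp [hdiag, mul_comm]
    · rcases hoff i k h with h' | h' <;> simp [h, h']
  simp_rw [hC, Finset.sum_sub_distrib]
  simp [Finset.mul_sum]

/-- Crawley-Boevey's formula for `dim Ext¹_Λ(X, Y)`. -/
lemma ext1dim_eq (hsym : ∀ i j, C i j = C j i) (hdiag : ∀ i, C i i = 2)
    (hoff : ∀ i j, i ≠ j → C i j = 0 ∨ C i j = -1)
    (hsgn : ∀ i j, C i j = -1 → sgn i j * sgn j i = -1 ∧ (sgn i j = 1 ∨ sgn i j = -1))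
    (ι : K →ₗ[PreprojAlg C sgn] P) (π : P →ₗ[PreprojAlg C sgn] X)
    (hP : Module.Projective (PreprojAlg C sgn) P) (hι : Function.Injective ι)
    (hπ : Function.Surjective π) (hex : LinearMap.range ι = LinearMap.ker π) :
    (ext1dim ι Y : ℤ) =
      (finrank ℂ (X →ₗ[PreprojAlg C sgn] Y) : ℤ) +
        (finrank ℂ (Y →ₗ[PreprojAlg C sgn] X) : ℤ) -
        ∑ i, ∑ k, (dimv C sgn X i : ℤ) * (dimv C sgn Y k : ℤ) * C i k := by
  obtain ⟨σ⟩ := nonempty_vertexSplitting ι π hι hπ hex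
  have h := σ.ext1dim_add (Y := Y) hP
  have hs : ∀ i j, C i j = -1 → sgn i j ≠ 0 ∧ sgn i j = -sgn j i := by
    intro i j hij
    obtain ⟨h1, h2 | h2⟩ := hsgn i j hij <;> rw [h2] at h1 ⊢ <;> constructor <;> omega
  rw [finrank_range_dOne hsym hs, finrank_arrow] at h
  have hXY := LinearMap.finrank_range_add_finrank_ker (dZero C sgn X Y)
  have hYX := LinearMap.finrank_range_add_finrank_ker (dZero C sgn Y X)
  rw [← homEquivKer.finrank_eq, finrank_vertex] at hXY hYX
  have hcomm : ∑ i, dimv C sgn Y i * dimv C sgn X i = ∑ i, dimv C sgn X i * dimv C sgn Y i :=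
    Finset.sum_congr rfl fun i _ => mul_comm _ _
  rw [hcomm] at hYX
  rw [cartan_form_eq hdiag hoff]
  omega

end Presentation

end PreprojectiveModules

/-!
STATEMENT 3 (Crawley-Boevey's formula).  Let `Λ` be the preprojective algebra of a Dynkin
quiver.  For any finite-dimensional `Λ`-modules `X, Y`:
`dim Ext¹_Λ(X,Y) = dim Hom_Λ(X,Y) + dim Hom_Λ(Y,X) − (dim X, dim Y)`,
where `(ν, μ) = ∑_{i,k} ν_i μ_k c_{ik}` is the symmetrized Cartan form on dimension
vectors; in particular `dim Ext¹_Λ(X,Y) = dim Ext¹_Λ(Y,X)`.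
(`dim Ext¹` is computed from arbitrary projective presentations.)
-/
theorem stmt_3 {I : Type} [Fintype I] [DecidableEq I]
    (C : I → I → ℤ) (sgn : I → I → ℤ)
    (hsym : ∀ i j, C i j = C j i) (hdiag : ∀ i, C i i = 2)
    (hoff : ∀ i j, i ≠ j → C i j = 0 ∨ C i j = -1)
    -- `C` is of Dynkin type, i.e. positive definite:
    (hpos : ∀ v : I → ℚ, v ≠ 0 → 0 < ∑ i, ∑ k, v i * v k * (C i k : ℚ))
    -- `sgn` comes from an orientation `Ω` of the graph:
    (hsgn : ∀ i j, C i j = -1 → sgn i j * sgn j i = -1 ∧ (sgn i j = 1 ∨ sgn i j = -1))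
    (X Y : Type)
    [AddCommGroup X] [Module (PreprojAlg C sgn) X] [Module ℂ X]
    [SMulCommClass (PreprojAlg C sgn) ℂ X] [IsScalarTower ℂ (PreprojAlg C sgn) X]
    [FiniteDimensional ℂ X]
    [AddCommGroup Y] [Module (PreprojAlg C sgn) Y] [Module ℂ Y]
    [SMulCommClass (PreprojAlg C sgn) ℂ Y] [IsScalarTower ℂ (PreprojAlg C sgn) Y]
    [FiniteDimensional ℂ Y]
    -- a projective presentation 0 → KX → PX → X → 0 of X
    (KX PX : Type)
    [AddCommGroup KX] [Module (PreprojAlg C sgn) KX]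
    [AddCommGroup PX] [Module (PreprojAlg C sgn) PX]
    (ιX : KX →ₗ[PreprojAlg C sgn] PX) (πX : PX →ₗ[PreprojAlg C sgn] X)
    (hPX : Module.Projective (PreprojAlg C sgn) PX) (hιX : Function.Injective ιX)
    (hπX : Function.Surjective πX) (hexX : LinearMap.range ιX = LinearMap.ker πX)
    -- a projective presentation 0 → KY → PY → Y → 0 of Y
    (KY PY : Type)
    [AddCommGroup KY] [Module (PreprojAlg C sgn) KY]
    [AddCommGroup PY] [Module (PreprojAlg C sgn) PY]
    (ιY : KY →ₗ[PreprojAlg C sgn] PY) (πY : PY →ₗ[PreprojAlg C sgn] Y)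
    (hPY : Module.Projective (PreprojAlg C sgn) PY) (hιY : Function.Injective ιY)
    (hπY : Function.Surjective πY) (hexY : LinearMap.range ιY = LinearMap.ker πY) :
    (ext1dim ιX Y : ℤ) =
      (finrank ℂ (X →ₗ[PreprojAlg C sgn] Y) : ℤ) +
        (finrank ℂ (Y →ₗ[PreprojAlg C sgn] X) : ℤ) -
        ∑ i, ∑ k, (dimv C sgn X i : ℤ) * (dimv C sgn Y k : ℤ) * C i k ∧
    ext1dim ιX Y = ext1dim ιY X := by
  let _ := Module.compHom KX (algebraMap ℂ (PreprojAlg C sgn))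
  let _ := Module.compHom PX (algebraMap ℂ (PreprojAlg C sgn))
  let _ := Module.compHom KY (algebraMap ℂ (PreprojAlg C sgn))
  let _ := Module.compHom PY (algebraMap ℂ (PreprojAlg C sgn))
  have : IsScalarTower ℂ (PreprojAlg C sgn) KX := .of_algebraMap_smul fun _ _ => rfl
  have : IsScalarTower ℂ (PreprojAlg C sgn) PX := .of_algebraMap_smul fun _ _ => rfl
  have : IsScalarTower ℂ (PreprojAlg C sgn) KY := .of_algebraMap_smul fun _ _ => rfl
  have : IsScalarTower ℂ (PreprojAlg C sgn) PY := .of_algebraMap_smul fun _ _ => rfl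
  have hX := ext1dim_eq (Y := Y) hsym hdiag hoff hsgn ιX πX hPX hιX hπX hexX
  have hY := ext1dim_eq (Y := X) hsym hdiag hoff hsgn ιY πY hPY hιY hπY hexY
  refine ⟨hX, ?_⟩
  have hform : ∑ i, ∑ k, (dimv C sgn Y i : ℤ) * (dimv C sgn X k : ℤ) * C i k =
      ∑ i, ∑ k, (dimv C sgn X i : ℤ) * (dimv C sgn Y k : ℤ) * C i k := by
    rw [Finset.sum_comm]
    refine Finset.sum_congr rfl fun i _ => Finset.sum_congr rfl fun k _ => ?_
    rw [hsym k i, mul_comm (dimv C sgn Y k : ℤ)]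
  rw [hform] at hY
  omega
end
end

section
/- Let Λ be the preprojective algebra of a simply-laced Dynkin quiver, T a finite-dimensional Λ-module, j a vertex, and S_j the simple module at j. Then dim Ext¹_Λ(T, S_j) = dim Hom_Λ(T, S_j) + dim Hom_Λ(S_j, T) + ⟨h_j, wt(T)⟩, where wt(T) = −dim T viewed in the root lattice; in particular dim Hom_Λ(T,S_j) + dim Hom_Λ(S_j,T) ≥ −⟨h_j, wt(T)⟩. -/
noncomputable section
open Module

variable {I : Type} [Fintype I] [DecidableEq I]

namespace PreprojAlg

variable (C sgn : I → I → ℤ)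

/-- The class in `Λ` of the arrow `i → l`. -/
def arr (i l : I) : PreprojAlg C sgn :=
  RingQuot.mkRingHom (PRel C sgn) (FreeAlgebra.ι ℂ (PGen.arrow i l))

theorem pe_mul_pe (i k : I) :
    pe C sgn i * pe C sgn k = if i = k then pe C sgn i else 0 := by
  have h := RingQuot.mkRingHom_rel (PRel.idem_mul (C := C) (sgn := sgn) i k)
  rw [map_mul] at h
  refine h.trans ?_
  split_ifs
  · rfl
  · exact map_zero _

theorem sum_pe : ∑ i, pe C sgn i = 1 := by
  have h := RingQuot.mkRingHom_rel (PRel.idem_sum (C := C) (sgn := sgn))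
  rw [map_sum, map_one] at h
  exact h

theorem arr_mul_pe (i l : I) : arr C sgn i l * pe C sgn i = arr C sgn i l := by
  have h := RingQuot.mkRingHom_rel (PRel.arrow_src (C := C) (sgn := sgn) i l)
  rw [map_mul] at h
  exact h

theorem pe_mul_arr (i l : I) : pe C sgn l * arr C sgn i l = arr C sgn i l := by
  have h := RingQuot.mkRingHom_rel (PRel.arrow_tgt (C := C) (sgn := sgn) i l)
  rw [map_mul] at h
  exact h

theorem sum_arr_mul_arr (i : I) :
    ∑ l, sgn l i • (arr C sgn l i * arr C sgn i l) = 0 := by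
  have h := RingQuot.mkRingHom_rel (PRel.preproj (C := C) (sgn := sgn) i)
  simp only [map_sum, map_zsmul, map_mul, map_zero] at h
  exact h

variable {C sgn}

theorem arr_eq_zero {i l : I} (h : C i l ≠ -1) : arr C sgn i l = 0 := by
  have h := RingQuot.mkRingHom_rel (PRel.arrow_zero (C := C) (sgn := sgn) i l h)
  rw [map_zero] at h
  exact h

theorem pe_mul_arr_of_ne {i l k : I} (h : k ≠ l) : pe C sgn k * arr C sgn i l = 0 := by
  rw [← pe_mul_arr, ← mul_assoc, pe_mul_pe, if_neg h, zero_mul]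

theorem arr_mul_pe_of_ne {i l k : I} (h : i ≠ k) : arr C sgn i l * pe C sgn k = 0 := by
  rw [← arr_mul_pe, mul_assoc, pe_mul_pe, if_neg h, mul_zero]

@[elab_as_elim]
theorem induction {p : PreprojAlg C sgn → Prop}
    (algebraMap : ∀ c : ℂ, p (algebraMap ℂ _ c)) (pe : ∀ i, p (pe C sgn i))
    (arr : ∀ i l, p (arr C sgn i l)) (mul : ∀ x y, p x → p y → p (x * y))
    (add : ∀ x y, p x → p y → p (x + y)) (x : PreprojAlg C sgn) : p x := by
  obtain ⟨a, rfl⟩ := RingQuot.mkAlgHom_surjective ℂ (PRel C sgn) x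
  induction a using FreeAlgebra.induction with
  | grade0 c => rw [AlgHom.commutes]; exact algebraMap c
  | grade1 g =>
    rw [← AlgHom.coe_toRingHom, RingQuot.mkAlgHom_coe]
    cases g with
    | idem i => exact pe i
    | arrow i l => exact arr i l
  | mul a b ha hb => rw [map_mul]; exact mul _ _ ha hb
  | add a b ha hb => rw [map_add]; exact add _ _ ha hb

/-- A representation of the double quiver satisfying the preprojective relations extends to `Λ`. -/
theorem exists_algHom {A : Type} [Ring A] [Algebra ℂ A] (e : I → A) (a : I → I → A)
    (idem_mul : ∀ i k, e i * e k = if i = k then e i else 0) (idem_sum : ∑ i, e i = 1)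
    (src : ∀ i l, a i l * e i = a i l) (tgt : ∀ i l, e l * a i l = a i l)
    (zero : ∀ i l, C i l ≠ -1 → a i l = 0)
    (preproj : ∀ i, ∑ l, sgn l i • (a l i * a i l) = 0) :
    ∃ ρ : PreprojAlg C sgn →ₐ[ℂ] A, (∀ i, ρ (pe C sgn i) = e i) ∧
      ∀ i l, ρ (arr C sgn i l) = a i l := by
  let F : FreeAlgebra ℂ (PGen I) →ₐ[ℂ] A :=
    FreeAlgebra.lift ℂ fun g => PGen.rec e a g
  have hF : ∀ ⦃x y⦄, PRel C sgn x y → F x = F y := by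
    intro x y h
    cases h with
    | idem_mul i k =>
      have := idem_mul i k
      split_ifs at this ⊢ <;> simpa [F] using this
    | idem_sum => simpa [F] using idem_sum
    | arrow_src i l => simpa [F] using src i l
    | arrow_tgt i l => simpa [F] using tgt i l
    | arrow_zero i l h => simpa [F] using zero i l h
    | preproj i => simpa [F] using preproj i
  refine ⟨RingQuot.liftAlgHom ℂ ⟨F, hF⟩, fun i => ?_, fun i l => ?_⟩
  · unfold pe
    rw [← RingQuot.mkAlgHom_coe ℂ]
    exact (RingQuot.liftAlgHom_mkAlgHom_apply ℂ F hF _).trans (by simp [F])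
  · unfold arr
    rw [← RingQuot.mkAlgHom_coe ℂ]
    exact (RingQuot.liftAlgHom_mkAlgHom_apply ℂ F hF _).trans (by simp [F])

section Modules

variable {M N : Type}
  [AddCommGroup M] [Module (PreprojAlg C sgn) M] [Module ℂ M] [IsScalarTower ℂ (PreprojAlg C sgn) M]
  [AddCommGroup N] [Module (PreprojAlg C sgn) N] [Module ℂ N] [IsScalarTower ℂ (PreprojAlg C sgn) N]

/-- A linear map commuting with the idempotents and the arrows is `Λ`-linear. -/
def homOfGenerators (f : M →ₗ[ℂ] N) (he : ∀ i m, f (pe C sgn i • m) = pe C sgn i • f m)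
    (ha : ∀ i l m, f (arr C sgn i l • m) = arr C sgn i l • f m) : M →ₗ[PreprojAlg C sgn] N where
  toFun := f
  map_add' := map_add f
  map_smul' x := by
    induction x using PreprojAlg.induction with
    | algebraMap c => intro m; simp [algebraMap_smul]
    | pe i => exact he i
    | arr i l => exact ha i l
    | mul x y hx hy => intro m; simpa [mul_smul, hy] using hx (y • m)
    | add x y hx hy => intro m; simp_all [add_smul]

end Modules

section Simple

variable {S : Type} [AddCommGroup S] [Module (PreprojAlg C sgn) S] {j : I}

theorem pe_smul_simple (hSj : ∀ x : S, pe C sgn j • x = x) (i : I) (s : S) :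
    pe C sgn i • s = if i = j then s else 0 := by
  split_ifs with h
  · rw [h, hSj]
  · rw [← hSj s, ← mul_smul, pe_mul_pe, if_neg h, zero_smul]

theorem arr_smul_simple (hdiag : ∀ i, C i i = 2) (hSj : ∀ x : S, pe C sgn j • x = x)
    (i l : I) (s : S) : arr C sgn i l • s = 0 := by
  by_cases hl : l = j
  · by_cases hi : i = j
    · rw [arr_eq_zero (by rw [hi, hl, hdiag]; decide), zero_smul]
    · rw [← hSj s, ← mul_smul, arr_mul_pe_of_ne hi, zero_smul]
  · rw [← hSj (arr C sgn i l • s), ← mul_smul, pe_mul_arr_of_ne (Ne.symm hl), zero_smul]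

/-- A linear map into `S_j` which factors through `e_j` and kills all arrows is `Λ`-linear. -/
def homToSimple {M : Type} [AddCommGroup M] [Module (PreprojAlg C sgn) M] [Module ℂ M]
    [IsScalarTower ℂ (PreprojAlg C sgn) M] [Module ℂ S] [IsScalarTower ℂ (PreprojAlg C sgn) S]
    (hdiag : ∀ i, C i i = 2) (hSj : ∀ x : S, pe C sgn j • x = x)
    (f : M →ₗ[ℂ] S) (he : ∀ i m, f (pe C sgn i • m) = if i = j then f m else 0)
    (ha : ∀ i l m, f (arr C sgn i l • m) = 0) : M →ₗ[PreprojAlg C sgn] S :=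
  homOfGenerators f (fun i m => by rw [he, pe_smul_simple hSj])
    fun i l m => by rw [ha, arr_smul_simple hdiag hSj]

end Simple

section LinearAlgebra

variable {V W S : Type} [AddCommGroup V] [Module ℂ V]
  [AddCommGroup W] [Module ℂ W] [AddCommGroup S] [Module ℂ S]

theorem exists_factor (f : V →ₗ[ℂ] W) (g : V →ₗ[ℂ] S) (h : ∀ v, f v = 0 → g v = 0) :
    ∃ u : W →ₗ[ℂ] S, ∀ v, u (f v) = g v := by
  let q : LinearMap.range f →ₗ[ℂ] S :=
    f.ker.liftQ g (fun v hv => h v hv) ∘ₗ f.quotKerEquivRange.symm.toLinearMap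
  obtain ⟨u, hu⟩ := q.exists_extend
  refine ⟨u, fun v => ?_⟩
  have := LinearMap.congr_fun hu ⟨f v, v, rfl⟩
  have h2 : f.quotKerEquivRange.symm ⟨f v, v, rfl⟩ = f.ker.mkQ v :=
    LinearMap.quotKerEquivRange_symm_apply_image f v _
  simp only [LinearMap.comp_apply, q, Submodule.subtype_apply, LinearEquiv.coe_coe, h2] at this
  exact this

/-- The subspace of maps `V → S` vanishing on the range of `f`. -/
def annih (S : Type) [AddCommGroup S] [Module ℂ S] (f : W →ₗ[ℂ] V) : Submodule ℂ (V →ₗ[ℂ] S) :=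
  LinearMap.ker (LinearMap.lcomp ℂ S (LinearMap.range f).subtype)

theorem mem_annih {f : W →ₗ[ℂ] V} {φ : V →ₗ[ℂ] S} : φ ∈ annih S f ↔ ∀ w, φ (f w) = 0 := by
  simp only [annih, LinearMap.mem_ker, LinearMap.ext_iff]
  constructor
  · intro h w
    exact h ⟨f w, w, rfl⟩
  · rintro h ⟨_, w, rfl⟩
    exact h w

theorem finrank_annih [FiniteDimensional ℂ V] (hS : finrank ℂ S = 1) (f : W →ₗ[ℂ] V) :
    finrank ℂ (annih S f) + finrank ℂ (LinearMap.range f) = finrank ℂ V := by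
  have : FiniteDimensional ℂ S := Module.finite_of_finrank_eq_succ hS
  have hsurj : Function.Surjective (LinearMap.lcomp ℂ S (LinearMap.range f).subtype) :=
    fun φ => φ.exists_extend
  have h := (LinearMap.lcomp ℂ S (LinearMap.range f).subtype).finrank_range_add_finrank_ker
  rw [LinearMap.range_eq_top.2 hsurj, finrank_top, Module.finrank_linearMap,
    Module.finrank_linearMap, hS, mul_one, mul_one] at h
  rw [add_comm]
  exact h

end LinearAlgebra

section Maps

variable (C sgn) (T : Type) [AddCommGroup T] [Module (PreprojAlg C sgn) T] [Module ℂ T]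
  [SMulCommClass (PreprojAlg C sgn) ℂ T] [IsScalarTower ℂ (PreprojAlg C sgn) T] (j : I)

/-- The component `e_i T`. -/
abbrev comp (i : I) : Submodule ℂ T := LinearMap.range (smulIdem C sgn T i)

/-- The neighbours of `j` in the Dynkin graph. -/
abbrev Nbr (C : I → I → ℤ) (j : I) : Type := {k : I // C k j = -1}

omit [IsScalarTower ℂ (PreprojAlg C sgn) T] in
variable {C sgn T} in
theorem mem_comp {i : I} {t : T} : t ∈ comp C sgn T i ↔ pe C sgn i • t = t := by
  constructor
  · rintro ⟨t, rfl⟩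
    change pe C sgn i • pe C sgn i • t = pe C sgn i • t
    rw [← mul_smul, pe_mul_pe, if_pos rfl]
  · exact fun h => ⟨t, h⟩

omit [IsScalarTower ℂ (PreprojAlg C sgn) T] in
variable {C sgn T} in
theorem pe_smul_comp {i : I} (t : comp C sgn T i) : pe C sgn i • (t : T) = t :=
  mem_comp.1 t.2

/-- The map `⨁_k e_k T → e_j T` given by the arrows into `j`. -/
def inMap : ((k : Nbr C j) → comp C sgn T k) →ₗ[ℂ] comp C sgn T j :=
  LinearMap.codRestrict _
    (∑ k : Nbr C j, Algebra.lsmul ℂ ℂ T (arr C sgn k j) ∘ₗ (comp C sgn T k).subtype ∘ₗ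
      LinearMap.proj k) fun v => mem_comp.2 <| by
    simp [Finset.smul_sum, ← mul_smul, pe_mul_arr]

/-- The map `e_j T → ⨁_k e_k T` given by the signed arrows out of `j`. -/
def outMap : comp C sgn T j →ₗ[ℂ] ((k : Nbr C j) → comp C sgn T k) :=
  LinearMap.pi fun k => LinearMap.codRestrict _
    (sgn k j • (Algebra.lsmul ℂ ℂ T (arr C sgn j k) ∘ₗ (comp C sgn T j).subtype))
    fun t => mem_comp.2 <| by
      simp [smul_comm _ (sgn k j), ← mul_smul, pe_mul_arr]

theorem inMap_apply (v : (k : Nbr C j) → comp C sgn T k) :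
    (inMap C sgn T j v : T) = ∑ k : Nbr C j, arr C sgn k j • (v k : T) := by
  simp [inMap]

theorem inMap_single (k : Nbr C j) (t : comp C sgn T k) :
    (inMap C sgn T j (Pi.single k t) : T) = arr C sgn k j • (t : T) := by
  rw [inMap_apply, Finset.sum_eq_single k]
  · rw [Pi.single_eq_same]
  · intro i _ hi
    rw [Pi.single_eq_of_ne hi]
    simp
  · simp

theorem outMap_apply (t : comp C sgn T j) (k : Nbr C j) :
    (outMap C sgn T j t k : T) = sgn k j • arr C sgn j k • (t : T) := by
  simp [outMap]

omit [DecidableEq I] in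
variable {C} in
theorem sum_nbr {A : Type} [AddCommGroup A] (f : I → A) (hf : ∀ k, C k j ≠ -1 → f k = 0) :
    ∑ k : Nbr C j, f k = ∑ k, f k := by
  rw [← Finset.sum_subtype {k | C k j = -1} (by simp) f]
  exact Finset.sum_filter_of_ne fun k _ hk => by_contra fun h => hk (hf k h)

theorem sum_arr_smul_arr_smul {M : Type} [AddCommGroup M] [Module (PreprojAlg C sgn) M] (m : M) :
    ∑ k : Nbr C j, arr C sgn k j • sgn k j • arr C sgn j k • m = 0 := by
  rw [sum_nbr j (fun k => arr C sgn k j • sgn k j • arr C sgn j k • m)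
    fun k hk => by rw [arr_eq_zero hk, zero_smul]]
  have h := congrArg (fun x => x • m) (sum_arr_mul_arr C sgn j)
  simp only [Finset.sum_smul, zero_smul, smul_assoc, mul_smul] at h
  simpa only [smul_comm (arr C sgn _ _) (sgn _ _)] using h

theorem inMap_outMap (t : comp C sgn T j) : inMap C sgn T j (outMap C sgn T j t) = 0 := by
  apply Subtype.ext
  rw [inMap_apply, ZeroMemClass.coe_zero]
  simp only [outMap_apply]
  exact sum_arr_smul_arr_smul C sgn j (t : T)

variable [FiniteDimensional ℂ T] (S : Type) [AddCommGroup S] [Module (PreprojAlg C sgn) S]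
  [Module ℂ S] [SMulCommClass (PreprojAlg C sgn) ℂ S] [IsScalarTower ℂ (PreprojAlg C sgn) S]

theorem finrank_hom_to_simple (hdiag : ∀ i, C i i = 2) (hS1 : finrank ℂ S = 1)
    (hSj : ∀ x : S, pe C sgn j • x = x) :
    finrank ℂ (T →ₗ[PreprojAlg C sgn] S) + finrank ℂ (LinearMap.range (inMap C sgn T j)) =
      dimv C sgn T j := by
  rw [dimv, ← finrank_annih hS1 (inMap C sgn T j)]
  congr 1
  let R : (T →ₗ[PreprojAlg C sgn] S) →ₗ[ℂ] (comp C sgn T j →ₗ[ℂ] S) :=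
    { toFun := fun h => h.restrictScalars ℂ ∘ₗ (comp C sgn T j).subtype
      map_add' := fun _ _ => rfl
      map_smul' := fun _ _ => rfl }
  have hR : ∀ h t, R h t = h t := fun _ _ => rfl
  have hinj : Function.Injective R := by
    intro h h' heq
    ext t
    have := LinearMap.congr_fun heq ⟨pe C sgn j • t, t, rfl⟩
    rwa [hR, hR, map_smul, map_smul, hSj, hSj] at this
  rw [← LinearMap.finrank_range_of_inj hinj]
  suffices h : LinearMap.range R = annih S (inMap C sgn T j) by rw [h]
  ext φ
  rw [mem_annih]
  constructor
  · rintro ⟨h, rfl⟩ v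
    rw [hR, inMap_apply, map_sum]
    exact Finset.sum_eq_zero fun k _ => by rw [map_smul, arr_smul_simple hdiag hSj]
  · intro hφ
    refine ⟨homToSimple hdiag hSj (φ ∘ₗ (smulIdem C sgn T j).rangeRestrict) ?_ ?_, ?_⟩
    · intro i t
      have : (smulIdem C sgn T j).rangeRestrict (pe C sgn i • t) =
          if i = j then (smulIdem C sgn T j).rangeRestrict t else 0 := by
        apply Subtype.ext
        change pe C sgn j • pe C sgn i • t = _
        rw [← mul_smul, pe_mul_pe]
        by_cases h : i = j
        · simp [h]; rfl
        · simp [h, Ne.symm h]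
      rw [LinearMap.comp_apply, this]
      split_ifs <;> simp
    · intro i l t
      rw [LinearMap.comp_apply]
      by_cases hl : l = j
      · subst hl
        by_cases hi : C i l = -1
        · rw [← hφ (Pi.single ⟨i, hi⟩ ((smulIdem C sgn T i).rangeRestrict t))]
          congr 1
          apply Subtype.ext
          rw [inMap_single]
          change pe C sgn l • arr C sgn i l • t = arr C sgn i l • pe C sgn i • t
          rw [← mul_smul, ← mul_smul, pe_mul_arr, arr_mul_pe]
        · rw [arr_eq_zero hi, zero_smul, map_zero, map_zero]
      · convert map_zero φ
        apply Subtype.ext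
        change pe C sgn j • arr C sgn i l • t = 0
        rw [← mul_smul, pe_mul_arr_of_ne (Ne.symm hl), zero_smul]
    · ext t
      change φ _ = φ t
      congr 1
      exact Subtype.ext (pe_smul_comp t)

omit [SMulCommClass (PreprojAlg C sgn) ℂ S] in
theorem finrank_hom_from_simple (hdiag : ∀ i, C i i = 2) (hsym : ∀ i k, C i k = C k i)
    (hsgn : ∀ k, C k j = -1 → sgn k j ≠ 0) (hS1 : finrank ℂ S = 1)
    (hSj : ∀ x : S, pe C sgn j • x = x) :
    finrank ℂ (S →ₗ[PreprojAlg C sgn] T) + finrank ℂ (LinearMap.range (outMap C sgn T j)) =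
      dimv C sgn T j := by
  rw [dimv, ← (outMap C sgn T j).finrank_range_add_finrank_ker, add_comm]
  congr 1
  obtain ⟨s, hs, hspan⟩ := finrank_eq_one_iff'.1 hS1
  let R : (S →ₗ[PreprojAlg C sgn] T) →ₗ[ℂ] comp C sgn T j :=
    { toFun := fun h => ⟨h s, mem_comp.2 <| by rw [← map_smul, hSj]⟩
      map_add' := fun _ _ => rfl
      map_smul' := fun _ _ => rfl }
  have hR : ∀ h, (R h : T) = h s := fun _ => rfl
  have hinj : Function.Injective R := by
    intro h h' heq
    ext x
    obtain ⟨c, rfl⟩ := hspan x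
    have := congrArg Subtype.val heq
    rw [hR, hR] at this
    rw [LinearMap.map_smul_of_tower, LinearMap.map_smul_of_tower, this]
  rw [← LinearMap.finrank_range_of_inj hinj]
  suffices h : LinearMap.range R = LinearMap.ker (outMap C sgn T j) by rw [h]
  ext t
  rw [LinearMap.mem_ker]
  constructor
  · rintro ⟨h, rfl⟩
    ext k
    rw [outMap_apply, hR, ← map_smul, arr_smul_simple hdiag hSj]
    simp
  · intro ht
    have : FiniteDimensional ℂ S := Module.finite_of_finrank_eq_succ hS1
    obtain ⟨u, hu⟩ := exists_factor (LinearMap.toSpanSingleton ℂ S s)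
      (LinearMap.toSpanSingleton ℂ T (t : T)) fun c hc => by
        have : c = 0 := by simpa [hs] using hc
        simp [this]
    have hu1 : u s = t := by simpa using hu 1
    have hut : ∀ x, ∃ c : ℂ, u x = c • (t : T) := fun x => by
      obtain ⟨c, rfl⟩ := hspan x
      exact ⟨c, by rw [map_smul, hu1]⟩
    refine ⟨homOfGenerators u ?_ ?_, Subtype.ext hu1⟩
    · intro i x
      obtain ⟨c, hc⟩ := hut x
      rw [pe_smul_simple hSj, hc, smul_comm]
      split_ifs with h
      · rw [h, pe_smul_comp, hc]
      · rw [← pe_smul_comp t, ← mul_smul, pe_mul_pe, if_neg h]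
        simp
    · intro i l x
      obtain ⟨c, hc⟩ := hut x
      rw [arr_smul_simple hdiag hSj, hc, smul_comm, map_zero]
      suffices arr C sgn i l • (t : T) = 0 by rw [this, smul_zero]
      by_cases hi : i = j
      · subst hi
        by_cases hl : C i l = -1
        · have hl' : C l i = -1 := by rw [hsym, hl]
          have := congrArg Subtype.val (congrFun ht ⟨l, hl'⟩)
          rw [outMap_apply] at this
          rw [← Int.cast_smul_eq_zsmul ℂ] at this
          exact (smul_eq_zero.1 this).resolve_left (Int.cast_ne_zero.2 (hsgn l hl'))
        · rw [arr_eq_zero hl, zero_smul]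
      · rw [← pe_smul_comp t, ← mul_smul, arr_mul_pe_of_ne hi, zero_smul]

variable {C sgn T j S} {P K : Type}
  [AddCommGroup P] [Module (PreprojAlg C sgn) P] [Module ℂ P] [IsScalarTower ℂ (PreprojAlg C sgn) P]
  [AddCommGroup K] [Module (PreprojAlg C sgn) K] [Module ℂ K] [IsScalarTower ℂ (PreprojAlg C sgn) K]

omit [Fintype I] [DecidableEq I] [FiniteDimensional ℂ T] in
/-- Lifting a map out of a projective module along a surjective map of representations. -/
theorem exists_lift {Λ P T M : Type} [Ring Λ] [Algebra ℂ Λ] [AddCommGroup P] [Module Λ P]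
    [Module ℂ P] [IsScalarTower ℂ Λ P] [AddCommGroup T] [Module Λ T] [Module ℂ T]
    [AddCommGroup M] [Module ℂ M] [Module.Projective Λ P]
    (π : P →ₗ[Λ] T) (ρ : Λ →ₐ[ℂ] Module.End ℂ M) (τ : M →ₗ[ℂ] T)
    (hτ : Function.Surjective τ) (hρ : ∀ x m, τ (ρ x m) = x • τ m) :
    ∃ G : P →ₗ[ℂ] M, (∀ x p, G (x • p) = ρ x (G p)) ∧ ∀ p, τ (G p) = π p := by
  let _ : Module Λ M := Module.compHom M ρ.toRingHom
  have : IsScalarTower ℂ Λ M := IsScalarTower.of_algebraMap_smul fun c m => by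
    change ρ (algebraMap ℂ Λ c) m = _
    rw [AlgHom.commutes]
    rfl
  let τ' : M →ₗ[Λ] T := { τ with map_smul' := hρ }
  obtain ⟨G, hG⟩ := Module.projective_lifting_property τ' π hτ
  exact ⟨G.restrictScalars ℂ, fun x p => map_smul G x p, fun p => LinearMap.congr_fun hG p⟩

omit [FiniteDimensional ℂ T] [SMulCommClass (PreprojAlg C sgn) ℂ S]
  [IsScalarTower ℂ (PreprojAlg C sgn) S] in
/-- A cocycle `ψ` defines an extension of `T` by `S_j`; lifting `P → T` to it gives `g`. -/
theorem exists_of_cocycle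
    (hSj : ∀ x : S, pe C sgn j • x = x) [Module.Projective (PreprojAlg C sgn) P]
    (π : P →ₗ[PreprojAlg C sgn] T) (ψ : I → T →ₗ[ℂ] S)
    (hψ1 : ∀ k t, ψ k (pe C sgn k • t) = ψ k t) (hψ2 : ∀ k, C k j ≠ -1 → ψ k = 0)
    (hψ3 : ∀ t, ∑ k, sgn k j • ψ k (arr C sgn j k • t) = 0) :
    ∃ g : P →ₗ[ℂ] S, (∀ i p, g (pe C sgn i • p) = if i = j then g p else 0) ∧
      ∀ i l p, g (arr C sgn i l • p) = if l = j then ψ i (π p) else 0 := by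
  let e : I → Module.End ℂ (T × S) := fun i =>
    LinearMap.prod (Algebra.lsmul ℂ ℂ T (pe C sgn i) ∘ₗ LinearMap.fst ℂ T S)
      (if i = j then LinearMap.snd ℂ T S else 0)
  let a : I → I → Module.End ℂ (T × S) := fun i l =>
    LinearMap.prod (Algebra.lsmul ℂ ℂ T (arr C sgn i l) ∘ₗ LinearMap.fst ℂ T S)
      (if l = j then ψ i ∘ₗ LinearMap.fst ℂ T S else 0)
  have he1 : ∀ i m, (e i m).1 = pe C sgn i • m.1 := fun _ _ => rfl
  have ha1 : ∀ i l m, (a i l m).1 = arr C sgn i l • m.1 := fun _ _ _ => rfl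
  have he2 : ∀ i m, (e i m).2 = if i = j then m.2 else 0 := fun i m => by
    simp only [e]; split_ifs <;> rfl
  have ha2 : ∀ i l m, (a i l m).2 = if l = j then ψ i m.1 else 0 := fun i l m => by
    simp only [a]; split_ifs <;> rfl
  have hψ0 : ∀ i, ψ i 0 = 0 := fun i => map_zero _
  obtain ⟨ρ, hρe, hρa⟩ := exists_algHom (C := C) (sgn := sgn) e a
    (fun i k => by
      refine LinearMap.ext fun m => ?_
      refine Prod.ext ?_ ?_
      · rw [Module.End.mul_apply, he1, he1, ← mul_smul, pe_mul_pe]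
        split_ifs
        · rw [he1]
        · simp
      · rw [Module.End.mul_apply, he2, he2]
        by_cases hik : i = k
        · subst hik
          simp only [if_true, he2]
          split_ifs <;> rfl
        · rw [if_neg hik]
          by_cases hi : i = j
          · rw [if_pos hi, if_neg (hi ▸ Ne.symm hik)]; rfl
          · rw [if_neg hi]; rfl)
    (by
      refine LinearMap.ext fun m => ?_
      refine Prod.ext ?_ ?_
      · simp [Prod.fst_sum, he1, ← Finset.sum_smul, sum_pe]
      · simp [Prod.snd_sum, he2])
    (fun i l => by
      refine LinearMap.ext fun m => ?_
      refine Prod.ext ?_ ?_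
      · rw [Module.End.mul_apply, ha1, he1, ← mul_smul, arr_mul_pe, ha1]
      · rw [Module.End.mul_apply, ha2, he1, hψ1, ha2])
    (fun i l => by
      refine LinearMap.ext fun m => ?_
      refine Prod.ext ?_ ?_
      · rw [Module.End.mul_apply, he1, ha1, ← mul_smul, pe_mul_arr]
      · rw [Module.End.mul_apply, he2, ha2]
        split_ifs <;> rfl)
    (fun i l h => by
      refine LinearMap.ext fun m => ?_
      refine Prod.ext ?_ ?_
      · rw [ha1, arr_eq_zero h, zero_smul]; rfl
      · rw [ha2]
        split_ifs with hl
        · rw [hψ2 i (hl ▸ h)]; rfl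
        · rfl)
    (fun i => by
      refine LinearMap.ext fun m => ?_
      refine Prod.ext ?_ ?_
      · have h := congrArg (fun x => x • m.1) (sum_arr_mul_arr C sgn i)
        simp only [Finset.sum_smul, zero_smul, smul_assoc, mul_smul] at h
        simpa [Prod.fst_sum, ha1] using h
      · by_cases hi : i = j
        · subst hi
          simpa [Prod.snd_sum, ha1, ha2] using hψ3 m.1
        · simp [Prod.snd_sum, ha2, hi])
  obtain ⟨G, hG, hGπ⟩ := exists_lift π ρ (LinearMap.fst ℂ T S) LinearMap.fst_surjective
    fun x => by
      induction x using PreprojAlg.induction with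
      | algebraMap c => intro m; rw [AlgHom.commutes, algebraMap_smul]; rfl
      | pe i => intro m; rw [hρe]; rfl
      | arr i l => intro m; rw [hρa]; rfl
      | mul x y hx hy => intro m; rw [map_mul, Module.End.mul_apply, hx, hy, mul_smul]
      | add x y hx hy => intro m; rw [map_add, LinearMap.add_apply, map_add, hx, hy, add_smul]
  have hG1 : ∀ p, (G p).1 = π p := hGπ
  refine ⟨LinearMap.snd ℂ T S ∘ₗ G, fun i p => ?_, fun i l p => ?_⟩
  · rw [LinearMap.comp_apply, hG, hρe, LinearMap.snd_apply, he2]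
    rfl
  · rw [LinearMap.comp_apply, hG, hρa, LinearMap.snd_apply, ha2, hG1]

theorem ext1dim_add (hdiag : ∀ i, C i i = 2) (hS1 : finrank ℂ S = 1)
    (hSj : ∀ x : S, pe C sgn j • x = x) [Module.Projective (PreprojAlg C sgn) P]
    (ι : K →ₗ[PreprojAlg C sgn] P) (π : P →ₗ[PreprojAlg C sgn] T) (hι : Function.Injective ι)
    (hπ : Function.Surjective π) (hex : LinearMap.range ι = LinearMap.ker π) :
    ext1dim ι S + finrank ℂ (LinearMap.range (inMap C sgn T j)) +
      finrank ℂ (LinearMap.range (outMap C sgn T j)) = ∑ k : Nbr C j, dimv C sgn T k := by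
  have hπι : ∀ y, π (ι y) = 0 := fun y => by
    have : ι y ∈ LinearMap.ker π := hex ▸ ⟨y, rfl⟩
    exact this
  obtain ⟨σ, hσ⟩ := (π.restrictScalars ℂ).exists_rightInverse_of_surjective
    (LinearMap.range_eq_top.2 hπ)
  replace hσ : ∀ t, π (σ t) = t := LinearMap.congr_fun hσ
  obtain ⟨r, hr⟩ := (ι.restrictScalars ℂ).exists_leftInverse_of_injective
    (LinearMap.ker_eq_bot.2 hι)
  replace hr : ∀ y, r (ι y) = y := LinearMap.congr_fun hr
  have hιr : ∀ p, π p = 0 → ι (r p) = p := fun p hp => by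
    obtain ⟨y, rfl⟩ : p ∈ LinearMap.range ι := hex ▸ hp
    rw [hr]
  let V := (k : Nbr C j) → comp C sgn T k
  let L : V →ₗ[ℂ] P := ∑ k : Nbr C j, Algebra.lsmul ℂ ℂ P (arr C sgn k j) ∘ₗ σ ∘ₗ
    (comp C sgn T k).subtype ∘ₗ LinearMap.proj k
  have hL : ∀ v, L v = ∑ k : Nbr C j, arr C sgn k j • σ (v k : T) := fun v => by
    simp only [L, LinearMap.sum_apply]
    rfl
  have hLsingle : ∀ k t, L (Pi.single k t) = arr C sgn k j • σ (t : T) := fun k t => by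
    rw [hL, Finset.sum_eq_single k]
    · rw [Pi.single_eq_same]
    · intro i _ hi
      rw [Pi.single_eq_of_ne hi]
      simp
    · simp
  have hπL : ∀ v, π (L v) = inMap C sgn T j v := fun v => by
    rw [hL, map_sum, inMap_apply]
    simp only [map_smul, hσ]
  let Z := LinearMap.ker (inMap C sgn T j)
  have hιL : ∀ v : Z, ι (r (L v)) = L v := fun v => hιr _ <| by
    rw [hπL, LinearMap.mem_ker.1 v.2]; rfl
  let Φ : (K →ₗ[PreprojAlg C sgn] S) →ₗ[ℂ] (Z →ₗ[ℂ] S) :=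
    { toFun := fun f => f.restrictScalars ℂ ∘ₗ r ∘ₗ L ∘ₗ Z.subtype
      map_add' := fun _ _ => rfl
      map_smul' := fun _ _ => rfl }
  have hΦ : ∀ f v, Φ f v = f (r (L v)) := fun _ _ => rfl
  let B : comp C sgn T j →ₗ[ℂ] Z := (outMap C sgn T j).codRestrict Z (inMap_outMap C sgn T j)
  have hB : ∀ t, (B t : V) = outMap C sgn T j t := fun _ => rfl
  have hker : LinearMap.range (precomp (M := S) ι) = LinearMap.ker Φ := by
    ext f
    constructor
    · rintro ⟨h, rfl⟩
      rw [LinearMap.mem_ker]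
      ext v
      change h (ι (r (L v))) = 0
      rw [hιL, hL, map_sum]
      exact Finset.sum_eq_zero fun k _ => by rw [map_smul, arr_smul_simple hdiag hSj]
    · intro hf
      let g : P →ₗ[ℂ] S := f.restrictScalars ℂ ∘ₗ r ∘ₗ Algebra.lsmul ℂ ℂ P (pe C sgn j)
      have hg : ∀ p, g p = f (r (pe C sgn j • p)) := fun _ => rfl
      have hgι : ∀ y, g (ι y) = f y := fun y => by rw [hg, ← map_smul, hr, map_smul, hSj]
      have hgL : ∀ v, g (L v) = f (r (L v)) := fun v => by
        rw [hg, hL, Finset.smul_sum]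
        simp only [← mul_smul, pe_mul_arr]
      obtain ⟨u, hu⟩ := exists_factor (inMap C sgn T j) (g ∘ₗ L) fun v hv => by
        rw [LinearMap.comp_apply, hgL]
        exact LinearMap.congr_fun hf ⟨v, hv⟩
      replace hu : ∀ v, u (inMap C sgn T j v) = g (L v) := hu
      let e : T →ₗ[ℂ] comp C sgn T j := (smulIdem C sgn T j).rangeRestrict
      have he : ∀ t, (e t : T) = pe C sgn j • t := fun _ => rfl
      have hgarr : ∀ i l p p', π p = π p' → g (arr C sgn i l • p) = g (arr C sgn i l • p') := by
        intro i l p p' h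
        rw [← sub_eq_zero, ← map_sub, ← smul_sub, ← hιr (p - p') (by rw [map_sub, h, sub_self]),
          ← map_smul, hgι, map_smul, arr_smul_simple hdiag hSj]
      refine ⟨homToSimple hdiag hSj (g - u ∘ₗ e ∘ₗ π.restrictScalars ℂ) ?_ ?_, ?_⟩
      · intro i p
        have hp : g (pe C sgn i • p) = if i = j then g p else 0 := by
          rw [hg, ← mul_smul, pe_mul_pe]
          by_cases h : i = j
          · simp [h, hg]
          · simp [h, Ne.symm h]
        have ht : e (pe C sgn i • π p) = if i = j then e (π p) else 0 := by
          apply Subtype.ext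
          rw [he, ← mul_smul, pe_mul_pe]
          by_cases h : i = j
          · simp [h, he]
          · simp [h, Ne.symm h]
        simp only [LinearMap.sub_apply, LinearMap.comp_apply, LinearMap.restrictScalars_apply,
          map_smul, hp, ht]
        split_ifs <;> simp
      · intro i l p
        simp only [LinearMap.sub_apply, LinearMap.comp_apply, LinearMap.restrictScalars_apply,
          map_smul]
        by_cases hl : l = j
        · subst hl
          by_cases hi : C i l = -1
          · let t : comp C sgn T i := (smulIdem C sgn T i).rangeRestrict (π p)
            have ht : (t : T) = pe C sgn i • π p := rfl
            have h1 : e (arr C sgn i l • π p) = inMap C sgn T l (Pi.single ⟨i, hi⟩ t) := by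
              apply Subtype.ext
              rw [he, inMap_single, ht, ← mul_smul, ← mul_smul, pe_mul_arr, arr_mul_pe]
            rw [h1, hu, hLsingle, hgarr i l (σ t) (pe C sgn i • p) (by rw [hσ, ht, map_smul]),
              ← mul_smul, arr_mul_pe, sub_self]
          · rw [arr_eq_zero hi]
            simp
        · have h1 : e (arr C sgn i l • π p) = 0 := Subtype.ext <| by
            rw [he, ← mul_smul, pe_mul_arr_of_ne (Ne.symm hl), zero_smul]
            rfl
          rw [h1, hg, ← mul_smul, pe_mul_arr_of_ne (Ne.symm hl)]
          simp
      · ext y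
        change g (ι y) - u (e (π (ι y))) = f y
        rw [hπι, hgι, map_zero, map_zero, sub_zero]
  have hrange : LinearMap.range Φ = annih S B := by
    ext φ
    rw [mem_annih]
    constructor
    · rintro ⟨f, rfl⟩ t
      let y : Nbr C j → P := fun k =>
        σ (outMap C sgn T j t k : T) - sgn k j • arr C sgn j k • σ (t : T)
      have hy : ∀ k, ι (r (y k)) = y k := fun k => hιr _ <| by
        rw [map_sub, hσ, outMap_apply, map_zsmul, map_smul, hσ, sub_self]
      have hLy : L (outMap C sgn T j t) = ι (∑ k : Nbr C j, arr C sgn k j • r (y k)) := by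
        simp only [map_sum, map_smul, hy, y, smul_sub, Finset.sum_sub_distrib,
          sum_arr_smul_arr_smul C sgn j (σ (t : T)), sub_zero, hL]
      rw [hΦ, hB, hLy, hr, map_sum]
      exact Finset.sum_eq_zero fun k _ => by rw [map_smul, arr_smul_simple hdiag hSj]
    · intro hφ
      obtain ⟨ψ, hψ⟩ := φ.exists_extend
      replace hψ : ∀ v : Z, ψ v = φ v := LinearMap.congr_fun hψ
      have hψsum : ∀ v : V, ψ v = ∑ k, ψ (Pi.single k (v k)) := fun v => by
        rw [← map_sum, Finset.univ_sum_single]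
      let Ψ : I → T →ₗ[ℂ] S := fun k => if h : C k j = -1 then
        ψ ∘ₗ LinearMap.single ℂ _ (⟨k, h⟩ : Nbr C j) ∘ₗ (smulIdem C sgn T k).rangeRestrict else 0
      have hΨ0 : ∀ k, C k j ≠ -1 → Ψ k = 0 := fun k h => dif_neg h
      have hΨ : ∀ (k : Nbr C j) (t : T) (t' : comp C sgn T k), pe C sgn k • t = t' →
          Ψ k t = ψ (Pi.single k t') := fun k t t' h => by
        simp only [Ψ, dif_pos k.2]
        change ψ (Pi.single k _) = _
        congr 2
        exact Subtype.ext h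
      obtain ⟨g, hg1, hg2⟩ := exists_of_cocycle (P := P) hSj π Ψ
        (fun k t => by
          by_cases h : C k j = -1
          · rw [hΨ ⟨k, h⟩ t ⟨_, t, rfl⟩ rfl, hΨ ⟨k, h⟩ (pe C sgn k • t) ⟨_, t, rfl⟩]
            change pe C sgn k • pe C sgn k • t = pe C sgn k • t
            rw [← mul_smul, pe_mul_pe, if_pos rfl]
          · rw [hΨ0 k h]; rfl)
        hΨ0
        (fun t => by
          rw [← sum_nbr j (fun k => sgn k j • Ψ k (arr C sgn j k • t)) fun k hk => by
              rw [hΨ0 k hk, LinearMap.zero_apply, smul_zero],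
            ← hφ ⟨pe C sgn j • t, t, rfl⟩, ← hψ, hB, hψsum]
          refine Finset.sum_congr rfl fun k _ => ?_
          rw [← map_zsmul]
          refine hΨ k _ _ ?_
          rw [outMap_apply, smul_comm, ← mul_smul, ← mul_smul, pe_mul_arr, arr_mul_pe])
      refine ⟨homToSimple hdiag hSj (g ∘ₗ ι.restrictScalars ℂ) ?_ ?_, ?_⟩
      · intro i y
        simp only [LinearMap.comp_apply, LinearMap.restrictScalars_apply, map_smul, hg1]
      · intro i l y
        simp only [LinearMap.comp_apply, LinearMap.restrictScalars_apply, map_smul, hg2, hπι,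
          map_zero, ite_self]
      · ext v
        change g (ι (r (L v))) = φ v
        rw [hιL, hL, map_sum, ← hψ, hψsum]
        refine Finset.sum_congr rfl fun k _ => ?_
        rw [hg2, if_pos rfl, hσ]
        exact hΨ k _ _ (pe_smul_comp _)
  have h1 : finrank ℂ (LinearMap.range B) = finrank ℂ (LinearMap.range (outMap C sgn T j)) := by
    have : LinearMap.range (outMap C sgn T j) = (LinearMap.range B).map Z.subtype := by
      rw [← LinearMap.range_comp]; rfl
    rw [this]
    exact (Submodule.equivMapOfInjective Z.subtype Z.injective_subtype _).finrank_eq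
  have h2 := finrank_annih hS1 B
  have h3 := (inMap C sgn T j).finrank_range_add_finrank_ker
  rw [Module.finrank_pi_fintype] at h3
  have h4 : ext1dim ι S = finrank ℂ (annih S B) := by
    rw [ext1dim, hker, Φ.quotKerEquivRange.finrank_eq, hrange]
  simp only [dimv]
  rw [h4, ← h3, ← h2, h1]
  ring

end Maps

end PreprojAlg
/-!
STATEMENT 6.  Let `Λ` be the preprojective algebra of a simply-laced Dynkin quiver, `T` a
finite-dimensional `Λ`-module, `j` a vertex and `S_j` the simple module at `j`.  Then
`dim Ext¹_Λ(T, S_j) = dim Hom_Λ(T, S_j) + dim Hom_Λ(S_j, T) + ⟨h_j, wt(T)⟩`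
where `wt(T) = −dim T` in the root lattice, so `⟨h_j, wt(T)⟩ = −∑_k c_{jk} (dim T)_k`;
in particular `dim Hom_Λ(T,S_j) + dim Hom_Λ(S_j,T) ≥ −⟨h_j, wt(T)⟩ = ∑_k c_{jk} (dim T)_k`.
(`dim Ext¹` is computed from an arbitrary projective presentation of `T`.)
-/
theorem stmt_6 {I : Type} [Fintype I] [DecidableEq I]
    (C : I → I → ℤ) (sgn : I → I → ℤ)
    (hsym : ∀ i j, C i j = C j i) (hdiag : ∀ i, C i i = 2)
    (hoff : ∀ i j, i ≠ j → C i j = 0 ∨ C i j = -1)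
    -- `C` is of Dynkin type, i.e. positive definite:
    (hpos : ∀ v : I → ℚ, v ≠ 0 → 0 < ∑ i, ∑ k, v i * v k * (C i k : ℚ))
    -- `sgn` comes from an orientation `Ω` of the graph:
    (hsgn : ∀ i j, C i j = -1 → sgn i j * sgn j i = -1 ∧ (sgn i j = 1 ∨ sgn i j = -1))
    (j : I)
    (T : Type)
    [AddCommGroup T] [Module (PreprojAlg C sgn) T] [Module ℂ T]
    [SMulCommClass (PreprojAlg C sgn) ℂ T] [IsScalarTower ℂ (PreprojAlg C sgn) T]
    [FiniteDimensional ℂ T]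
    -- `S` is the simple module `S_j` at the vertex `j`:
    (S : Type)
    [AddCommGroup S] [Module (PreprojAlg C sgn) S] [Module ℂ S]
    [SMulCommClass (PreprojAlg C sgn) ℂ S] [IsScalarTower ℂ (PreprojAlg C sgn) S]
    (hS1 : finrank ℂ S = 1) (hSj : ∀ x : S, pe C sgn j • x = x)
    -- a projective presentation 0 → K → P → T → 0 of T
    (K P : Type)
    [AddCommGroup K] [Module (PreprojAlg C sgn) K]
    [AddCommGroup P] [Module (PreprojAlg C sgn) P]
    (ι : K →ₗ[PreprojAlg C sgn] P) (π : P →ₗ[PreprojAlg C sgn] T)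
    (hP : Module.Projective (PreprojAlg C sgn) P) (hι : Function.Injective ι)
    (hπ : Function.Surjective π) (hex : LinearMap.range ι = LinearMap.ker π) :
    (ext1dim ι S : ℤ) =
      (finrank ℂ (T →ₗ[PreprojAlg C sgn] S) : ℤ) +
        (finrank ℂ (S →ₗ[PreprojAlg C sgn] T) : ℤ) -
        ∑ k, C j k * (dimv C sgn T k : ℤ) ∧
    ∑ k, C j k * (dimv C sgn T k : ℤ) ≤
      (finrank ℂ (T →ₗ[PreprojAlg C sgn] S) : ℤ) +
        (finrank ℂ (S →ₗ[PreprojAlg C sgn] T) : ℤ) := by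
  let _ : Module ℂ P := Module.compHom P (algebraMap ℂ (PreprojAlg C sgn))
  let _ : Module ℂ K := Module.compHom K (algebraMap ℂ (PreprojAlg C sgn))
  have : IsScalarTower ℂ (PreprojAlg C sgn) P :=
    IsScalarTower.of_algebraMap_smul fun _ _ => rfl
  have : IsScalarTower ℂ (PreprojAlg C sgn) K :=
    IsScalarTower.of_algebraMap_smul fun _ _ => rfl
  have hext := PreprojAlg.ext1dim_add (S := S) hdiag hS1 hSj ι π hι hπ hex
  have hin := PreprojAlg.finrank_hom_to_simple C sgn T j S hdiag hS1 hSj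
  have hout := PreprojAlg.finrank_hom_from_simple C sgn T j S hdiag hsym
    (fun k hk h => by simpa [h] using (hsgn k j hk).1) hS1 hSj
  have hsum : ∑ k, C j k * (dimv C sgn T k : ℤ) =
      2 * (dimv C sgn T j : ℤ) - ∑ k : PreprojAlg.Nbr C j, (dimv C sgn T k : ℤ) := by
    have hnbr : ∑ k : PreprojAlg.Nbr C j, (dimv C sgn T k : ℤ) =
        ∑ k, if C k j = -1 then (dimv C sgn T k : ℤ) else 0 := by
      rw [← PreprojAlg.sum_nbr j _ fun k hk => if_neg hk]
      exact Finset.sum_congr rfl fun k _ => (if_pos k.2).symm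
    have hdiag' : 2 * (dimv C sgn T j : ℤ) =
        ∑ k, if k = j then 2 * (dimv C sgn T k : ℤ) else 0 := by simp
    rw [hnbr, hdiag', ← Finset.sum_sub_distrib]
    refine Finset.sum_congr rfl fun k _ => ?_
    by_cases hk : k = j
    · simp [hk, hdiag]
    · rcases hoff k j hk with h | h <;> simp [hk, h, hsym j k]
  zify at hext hin hout
  rw [hsum]
  constructor <;> linarith
end
end
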